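/- arXiv:1407.1822 — 5 statements merged into one kernel-verified Lean document; each statement's English description precedes it below -/
import Mathlib

section
/- Let a < 0 < x, c > 1, ε > 0 with x < 1 − ε and a·c < x, and let f : (a,1) → ℝ be differentiable with derivative bounded on every compact subinterval of (a,1). Then ∫_x^{1−ε} f(t)/((x−c·t)·√((t−a)(t−x))) dt = (1/√(x·(x−a·c))) · ∫_x^{1−ε} √(t/(t−a·c)) · [ (t²−a·c·(1−ε))·√(1−a−ε)·f(1−ε) / ( t·(t−a)·(t−c·(1−ε))·√(1−t−ε) ) − ∫_t^{1−ε} √(u−a)·f′(u)/((t−c·u)·√(u−t)) du − (a/(t·(t−a)))·∫_t^{1−ε} √(u−a)·f′(u)/√(u−t) du ] dt. -/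
open MeasureTheory Set

/-- A common primitive of the two algebraic kernels: up to the factor `√(t (t - a c))` it is
`∫ s in t..u, 1 / ((t - c s) √((s - a) (s - t)))`. -/
noncomputable def arctanKernel (a c t u : ℝ) : ℝ :=
  -(2 / √(c - 1)) * Real.arctan √((u - t) * (t - a * c) / ((u - a) * (c - 1) * t))

theorem hasDerivAt_arctan_sqrt {w : ℝ → ℝ} {w' y : ℝ} (hw : HasDerivAt w w' y) (hy : 0 < w y) :
    HasDerivAt (fun s ↦ Real.arctan √(w s)) (w' / (2 * (1 + w y) * √(w y))) y := by
  have h := (hw.sqrt hy.ne').arctan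
  rw [Real.sq_sqrt hy.le] at h
  convert h using 1
  field_simp

theorem hasDerivAt_arctanKernel_left {a c t u : ℝ} (ha : a < 0) (hc : 1 < c) (ht : 0 < t)
    (htu : t < u) :
    HasDerivAt (fun s ↦ arctanKernel a c s u)
      (-(√(t / (t - a * c)) * ((t ^ 2 - a * c * u) * √(u - a) / (t * (t - a) * (t - c * u)))
        / √(u - t))) t := by
  have hac : 0 < t - a * c := by nlinarith
  have hta : 0 < t - a := by linarith
  have hua : 0 < u - a := by linarith
  have hut : 0 < u - t := by linarith
  have hc1 : 0 < c - 1 := by linarith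
  have hcu : t - c * u ≠ 0 := by nlinarith
  have hw : HasDerivAt (fun s ↦ (u - s) * (s - a * c) / ((u - a) * (c - 1) * s))
      (-(t ^ 2 - a * c * u) / ((u - a) * (c - 1) * t ^ 2)) t := by
    have := ((((hasDerivAt_id' t).const_sub u).fun_mul
      ((hasDerivAt_id' t).sub_const (a * c))).fun_div
      ((hasDerivAt_id' t).const_mul ((u - a) * (c - 1))) (by positivity))
    refine this.congr_deriv ?_
    field_simp
    ring
  have h := (hasDerivAt_arctan_sqrt hw (by positivity)).const_mul (-(2 / √(c - 1)))
  refine h.congr_deriv ?_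
  have e : 1 + (u - t) * (t - a * c) / ((u - a) * (c - 1) * t) =
      -((t - a) * (t - c * u)) / ((u - a) * (c - 1) * t) := by
    field_simp
    ring
  rw [e, Real.sqrt_div (by positivity), Real.sqrt_div ht.le, Real.sqrt_mul hut.le,
    Real.sqrt_mul (by positivity), Real.sqrt_mul (by positivity)]
  have h1 : √(c - 1) ^ 2 = c - 1 := Real.sq_sqrt hc1.le
  have p1 := Real.sqrt_pos.2 hc1
  have p2 := Real.sqrt_pos.2 hut
  have p3 := Real.sqrt_pos.2 hua
  have p4 := Real.sqrt_pos.2 hac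
  have p5 := Real.sqrt_pos.2 ht
  field_simp

theorem hasDerivAt_arctanKernel_right {a c t u : ℝ} (ha : a < 0) (hc : 1 < c) (ht : 0 < t)
    (htu : t < u) :
    HasDerivAt (fun s ↦ arctanKernel a c t s)
      (√(t * (t - a * c)) / ((t - c * u) * √((u - a) * (u - t)))) u := by
  have hac : 0 < t - a * c := by nlinarith
  have hta : 0 < t - a := by linarith
  have hua : 0 < u - a := by linarith
  have hut : 0 < u - t := by linarith
  have hc1 : 0 < c - 1 := by linarith
  have hcu : t - c * u ≠ 0 := by nlinarith
  have hw : HasDerivAt (fun s ↦ (s - t) * (t - a * c) / ((s - a) * (c - 1) * t))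
      ((t - a * c) * (t - a) / ((c - 1) * t * (u - a) ^ 2)) u := by
    have := ((((hasDerivAt_id' u).sub_const t).mul_const (t - a * c)).fun_div
      ((((hasDerivAt_id' u).sub_const a).mul_const (c - 1)).mul_const t) (by positivity))
    refine this.congr_deriv ?_
    field_simp
    ring
  have h := (hasDerivAt_arctan_sqrt hw (by positivity)).const_mul (-(2 / √(c - 1)))
  refine h.congr_deriv ?_
  have e : 1 + (u - t) * (t - a * c) / ((u - a) * (c - 1) * t) =
      -((t - a) * (t - c * u)) / ((u - a) * (c - 1) * t) := by
    field_simp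
    ring
  rw [e, Real.sqrt_div (by positivity), Real.sqrt_mul hut.le, Real.sqrt_mul ht.le,
    Real.sqrt_mul (by positivity), Real.sqrt_mul (by positivity), Real.sqrt_mul hua.le]
  have h1 : √(c - 1) ^ 2 = c - 1 := Real.sq_sqrt hc1.le
  have h2 : √(u - a) ^ 2 = u - a := Real.sq_sqrt hua.le
  set q := t - a * c with hq
  have h3 : √q ^ 2 = q := Real.sq_sqrt hac.le
  have p1 := Real.sqrt_pos.2 hc1
  have p2 := Real.sqrt_pos.2 hut
  have p3 := Real.sqrt_pos.2 hua
  have p4 := Real.sqrt_pos.2 hac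
  have p5 := Real.sqrt_pos.2 ht
  clear_value q
  field_simp
  rw [h2, h3]
  ring

theorem intervalIntegrable_inv_sqrt_sub {p q : ℝ} (h : p ≤ q) :
    IntervalIntegrable (fun u ↦ (√(u - p))⁻¹) volume p q := by
  have h0 : IntervalIntegrable (fun u : ℝ ↦ u ^ (-(1 / 2) : ℝ)) volume (p - p) (q - p) :=
    intervalIntegral.intervalIntegrable_rpow' (by norm_num)
  refine (by simpa using h0.comp_sub_right p : IntervalIntegrable
    (fun u : ℝ ↦ (u - p) ^ (-(1 / 2) : ℝ)) volume p q).congr_uIoo fun u hu ↦ ?_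
  rw [uIoo_of_le h] at hu
  simp only [Real.rpow_neg (sub_nonneg.2 hu.1.le), Real.sqrt_eq_rpow]

theorem intervalIntegrable_div_sqrt_sub_left {g : ℝ → ℝ} {p q C : ℝ} (hpq : p ≤ q)
    (hg : Measurable g) (hC : ∀ u ∈ Ioc p q, |g u| ≤ C) :
    IntervalIntegrable (fun u ↦ g u / √(u - p)) volume p q := by
  refine ((intervalIntegrable_inv_sqrt_sub hpq).const_mul C).mono_fun'
    (Measurable.aestronglyMeasurable (by fun_prop)) ?_
  rw [uIoc_of_le hpq]
  filter_upwards [self_mem_ae_restrict measurableSet_Ioc] with u hu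
  rw [Real.norm_eq_abs, abs_div, abs_of_nonneg (Real.sqrt_nonneg _), div_eq_mul_inv]
  gcongr
  exact hC u hu

theorem intervalIntegrable_div_sqrt_sub_right {g : ℝ → ℝ} {p q C : ℝ} (hpq : p ≤ q)
    (hg : Measurable g) (hC : ∀ u ∈ Ico p q, |g u| ≤ C) :
    IntervalIntegrable (fun t ↦ g t / √(q - t)) volume p q := by
  have h := intervalIntegrable_div_sqrt_sub_left (g := fun v ↦ g (q - v)) (p := 0) (q := q - p)
    (C := C) (by linarith) (by fun_prop)
    fun v hv ↦ hC _ ⟨by linarith [hv.2], by linarith [hv.1]⟩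
  simpa using (h.comp_sub_left q).symm

/-- A bounded kernel divided by `√(u - t)` is integrable over the triangle `x < t < u ≤ b`. -/
theorem integrable_indicator_triangle_div_sqrt {m : ℝ → ℝ → ℝ} {x b C : ℝ} (hxb : x ≤ b)
    (hm : Measurable (Function.uncurry m))
    (hC : ∀ t u, x < t → t < u → u ≤ b → |m t u| ≤ C) :
    Integrable (fun p : ℝ × ℝ ↦ {p : ℝ × ℝ | x < p.2 ∧ p.2 < p.1 ∧ p.1 ≤ b}.indicator
      (fun p ↦ m p.2 p.1 / √(p.1 - p.2)) p) (volume.prod volume) := by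
  have hS : MeasurableSet {p : ℝ × ℝ | x < p.2 ∧ p.2 < p.1 ∧ p.1 ≤ b} := by
    measurability
  have h1 : Integrable ((Ioc x b).indicator fun _ ↦ C) volume :=
    (integrable_indicator_iff measurableSet_Ioc).2 (by simp)
  have h2 : Integrable ((Ioc 0 (b - x)).indicator fun s ↦ (√s)⁻¹) volume := by
    rw [integrable_indicator_iff measurableSet_Ioc]
    have := intervalIntegrable_inv_sqrt_sub (sub_nonneg.2 hxb)
    rw [intervalIntegrable_iff_integrableOn_Ioc_of_le (sub_nonneg.2 hxb)] at this
    simpa using this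
  refine (h1.convolution_integrand (ContinuousLinearMap.mul ℝ ℝ) h2).mono' ?_ (.of_forall ?_)
  · refine (Measurable.indicator ?_ hS).aestronglyMeasurable
    exact (hm.comp measurable_swap).div (by fun_prop)
  · rintro ⟨u, t⟩
    by_cases h : x < t ∧ t < u ∧ u ≤ b
    · obtain ⟨h1, h2, h3⟩ := h
      have e1 : t ∈ Ioc x b := ⟨h1, by linarith⟩
      have e2 : u - t ∈ Ioc 0 (b - x) := ⟨by linarith, by linarith⟩
      simp only [ContinuousLinearMap.mul_apply', indicator_of_mem e1, indicator_of_mem e2]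
      rw [indicator_of_mem (by exact ⟨h1, h2, h3⟩), Real.norm_eq_abs, abs_div,
        abs_of_nonneg (Real.sqrt_nonneg _), div_eq_mul_inv]
      gcongr
      exact hC t u h1 h2 h3
    · rw [indicator_of_notMem (by exact h), norm_zero]
      simp only [ContinuousLinearMap.mul_apply']
      by_cases e1 : t ∈ Ioc x b
      · by_cases e2 : u - t ∈ Ioc 0 (b - x)
        · have h0 : 0 ≤ C := (abs_nonneg _).trans
            (hC ((x + t) / 2) t (by linarith [e1.1]) (by linarith [e1.1]) e1.2)
          simp only [indicator_of_mem e1, indicator_of_mem e2]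
          positivity
        · simp [indicator_of_notMem e2]
      · simp [indicator_of_notMem e1]

theorem integral_indicator_triangle_fst {k : ℝ → ℝ → ℝ} {x b t : ℝ} :
    ∫ u, {p : ℝ × ℝ | x < p.2 ∧ p.2 < p.1 ∧ p.1 ≤ b}.indicator (fun p ↦ k p.2 p.1) (u, t) =
      (Ioc x b).indicator (fun t ↦ ∫ u in t..b, k t u) t := by
  by_cases ht : t ∈ Ioc x b
  · rw [indicator_of_mem ht, intervalIntegral.integral_of_le ht.2,
      ← integral_indicator measurableSet_Ioc]
    congr 1 with u
    simp [indicator_apply, ht.1]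
  · rw [indicator_of_notMem ht]
    convert integral_zero ℝ ℝ with u
    refine indicator_of_notMem (fun h ↦ ht ⟨h.1, h.2.1.le.trans h.2.2⟩) _

theorem integral_indicator_triangle_snd {k : ℝ → ℝ → ℝ} {x b u : ℝ} :
    ∫ t, {p : ℝ × ℝ | x < p.2 ∧ p.2 < p.1 ∧ p.1 ≤ b}.indicator (fun p ↦ k p.2 p.1) (u, t) =
      (Ioc x b).indicator (fun u ↦ ∫ t in x..u, k t u) u := by
  by_cases hu : u ∈ Ioc x b
  · rw [indicator_of_mem hu, intervalIntegral.integral_of_le hu.1.le, integral_Ioc_eq_integral_Ioo,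
      ← integral_indicator measurableSet_Ioo]
    congr 1 with t
    simp [indicator_apply, hu.2]
  · rw [indicator_of_notMem hu]
    convert integral_zero ℝ ℝ with t
    refine indicator_of_notMem (fun h ↦ hu ⟨h.1.trans h.2.1, h.2.2⟩) _

theorem intervalIntegrable_integral_div_sqrt {m : ℝ → ℝ → ℝ} {x b C : ℝ} (hxb : x ≤ b)
    (hm : Measurable (Function.uncurry m))
    (hC : ∀ t u, x < t → t < u → u ≤ b → |m t u| ≤ C) :
    IntervalIntegrable (fun t ↦ ∫ u in t..b, m t u / √(u - t)) volume x b := by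
  have h := (integrable_indicator_triangle_div_sqrt hxb hm hC).integral_prod_right
  simp only [integral_indicator_triangle_fst (k := fun t u ↦ m t u / √(u - t))] at h
  rwa [integrable_indicator_iff measurableSet_Ioc,
    ← intervalIntegrable_iff_integrableOn_Ioc_of_le hxb] at h

theorem integral_integral_swap_div_sqrt {m : ℝ → ℝ → ℝ} {x b C : ℝ} (hxb : x ≤ b)
    (hm : Measurable (Function.uncurry m))
    (hC : ∀ t u, x < t → t < u → u ≤ b → |m t u| ≤ C) :
    ∫ t in x..b, ∫ u in t..b, m t u / √(u - t) = ∫ u in x..b, ∫ t in x..u, m t u / √(u - t) := by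
  have h := integral_integral_swap
    (f := fun u t ↦ {p : ℝ × ℝ | x < p.2 ∧ p.2 < p.1 ∧ p.1 ≤ b}.indicator
      (fun p ↦ m p.2 p.1 / √(p.1 - p.2)) (u, t)) (integrable_indicator_triangle_div_sqrt hxb hm hC)
  simp only [integral_indicator_triangle_fst (k := fun t u ↦ m t u / √(u - t)),
    integral_indicator_triangle_snd (k := fun t u ↦ m t u / √(u - t))] at h
  rw [integral_indicator measurableSet_Ioc, integral_indicator measurableSet_Ioc] at h
  rw [intervalIntegral.integral_of_le hxb, intervalIntegral.integral_of_le hxb, h]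

theorem continuousOn_arctanKernel_left {a c x u : ℝ} (ha : a < 0) (hc : 1 < c) (hx : 0 < x)
    (hxu : x ≤ u) :
    ContinuousOn (fun s ↦ arctanKernel a c s u) (Icc x u) := by
  unfold arctanKernel
  refine ContinuousOn.mul continuousOn_const (Real.continuous_arctan.comp_continuousOn
    (ContinuousOn.sqrt (ContinuousOn.div (by fun_prop) (by fun_prop) ?_)))
  intro t ht
  have : 0 < t := hx.trans_le ht.1
  have : 0 < u - a := by linarith
  have : 0 < c - 1 := by linarith
  positivity

theorem continuousOn_arctanKernel_right {a c t b : ℝ} (ha : a < 0) (hc : 1 < c) (ht : 0 < t) :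
    ContinuousOn (fun u ↦ arctanKernel a c t u) (Icc t b) := by
  unfold arctanKernel
  refine ContinuousOn.mul continuousOn_const (Real.continuous_arctan.comp_continuousOn
    (ContinuousOn.sqrt (ContinuousOn.div (by fun_prop) (by fun_prop) ?_)))
  intro u hu
  have : 0 < u - a := by linarith [hu.1]
  have : 0 < c - 1 := by linarith
  positivity

/-- The factor of `-∂/∂t (arctanKernel a c t u)` that remains bounded as `t → u`; the full
derivative is this divided by `√(u - t)`. -/
noncomputable def regularKernel (a c t u : ℝ) : ℝ :=
  √(t / (t - a * c)) * ((t ^ 2 - a * c * u) * √(u - a) / (t * (t - a) * (t - c * u)))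

theorem measurable_regularKernel (a c : ℝ) :
    Measurable (Function.uncurry (regularKernel a c)) := by
  unfold Function.uncurry regularKernel
  fun_prop

theorem exists_abs_regularKernel_le {a c x : ℝ} (ha : a < 0) (hc : 1 < c) (hx : 0 < x) (b : ℝ) :
    ∃ C, ∀ t u, x ≤ t → t ≤ u → u ≤ b → |regularKernel a c t u| ≤ C := by
  have hK : IsCompact {p : ℝ × ℝ | x ≤ p.1 ∧ p.1 ≤ p.2 ∧ p.2 ≤ b} := by
    refine (isCompact_Icc.prod isCompact_Icc : IsCompact (Icc x b ×ˢ Icc x b)).of_isClosed_subset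
      ?_ fun p hp ↦ ⟨⟨hp.1, hp.2.1.trans hp.2.2⟩, hp.1.trans hp.2.1, hp.2.2⟩
    exact (isClosed_le continuous_const continuous_fst).inter
      ((isClosed_le continuous_fst continuous_snd).inter
        (isClosed_le continuous_snd continuous_const))
  obtain ⟨C, hC⟩ := hK.exists_bound_of_continuousOn
    (f := fun p : ℝ × ℝ ↦ regularKernel a c p.1 p.2) (by
      unfold regularKernel
      refine ContinuousOn.mul (ContinuousOn.sqrt (ContinuousOn.div (by fun_prop) (by fun_prop) ?_))
        (ContinuousOn.div (by fun_prop) (by fun_prop) ?_)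
      · rintro ⟨t, u⟩ ⟨h1, h2, -⟩
        simp only at h1 h2 ⊢
        nlinarith
      · rintro ⟨t, u⟩ ⟨h1, h2, -⟩
        simp only at h1 h2 ⊢
        have h3 : 0 < t := hx.trans_le h1
        have h4 : t - a ≠ 0 := by linarith
        have h5 : t - c * u ≠ 0 := by nlinarith
        positivity)
  exact ⟨C, fun t u h1 h2 h3 ↦ hC (t, u) ⟨h1, h2, h3⟩⟩

theorem intervalIntegrable_regularKernel {a c x u : ℝ} (ha : a < 0) (hc : 1 < c) (hx : 0 < x)
    (hxu : x ≤ u) :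
    IntervalIntegrable (fun t ↦ regularKernel a c t u / √(u - t)) volume x u := by
  obtain ⟨C, hC⟩ := exists_abs_regularKernel_le ha hc hx u
  exact intervalIntegrable_div_sqrt_sub_right hxu
    ((measurable_regularKernel a c).comp measurable_prodMk_right)
    fun t ht ↦ hC t u ht.1 ht.2.le le_rfl

theorem integral_regularKernel {a c x u : ℝ} (ha : a < 0) (hc : 1 < c) (hx : 0 < x)
    (hxu : x ≤ u) :
    ∫ t in x..u, regularKernel a c t u / √(u - t) = arctanKernel a c x u := by
  have h := intervalIntegral.integral_eq_sub_of_hasDerivAt_of_le hxu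
    (continuousOn_arctanKernel_left ha hc hx hxu)
    (fun t ht ↦ hasDerivAt_arctanKernel_left ha hc (hx.trans ht.1) ht.2)
    (intervalIntegrable_regularKernel ha hc hx hxu).neg
  rw [intervalIntegral.integral_neg] at h
  have h0 : arctanKernel a c u u = 0 := by simp [arctanKernel]
  rw [h0, zero_sub, neg_inj] at h
  exact h

theorem integral_div_sqrt_eq_arctanKernel {a c x b : ℝ} (ha : a < 0) (hc : 1 < c) (hx : 0 < x)
    (hxb : x ≤ b) {f : ℝ → ℝ} (hf : ∀ t ∈ Icc x b, DifferentiableAt ℝ f t)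
    (hf' : IntervalIntegrable (deriv f) volume x b) :
    ∫ t in x..b, f t / ((x - c * t) * √((t - a) * (t - x))) =
      (√(x * (x - a * c)))⁻¹ *
        (f b * arctanKernel a c x b - ∫ u in x..b, deriv f u * arctanKernel a c x u) := by
  have hP : 0 < √(x * (x - a * c)) := Real.sqrt_pos.2 (mul_pos hx (by nlinarith))
  have hcont : ContinuousOn (fun u ↦ √(x * (x - a * c)) / ((x - c * u) * √(u - a))) (Icc x b) := by
    refine ContinuousOn.div (by fun_prop) (by fun_prop) fun u hu ↦ ?_
    have h1 : x - c * u ≠ 0 := by nlinarith [hu.1]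
    have h2 : 0 < u - a := by linarith [hu.1]
    positivity
  obtain ⟨C, hC⟩ := isCompact_Icc.exists_bound_of_continuousOn hcont
  have hint := intervalIntegrable_div_sqrt_sub_left hxb (C := C) (by fun_prop)
    fun u hu ↦ hC u (Ioc_subset_Icc_self hu)
  have hparts := intervalIntegral.integral_mul_deriv_eq_deriv_mul_of_hasDerivAt (u := f)
    (v := arctanKernel a c x) (a := x) (b := b)
    (by rw [uIcc_of_le hxb]; exact fun t ht ↦ (hf t ht).continuousAt.continuousWithinAt)
    (by rw [uIcc_of_le hxb]; exact continuousOn_arctanKernel_right ha hc hx)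
    (fun t ht ↦ by
      rw [min_eq_left hxb, max_eq_right hxb] at ht
      exact (hf t (Ioo_subset_Icc_self ht)).hasDerivAt)
    (fun t ht ↦ by
      rw [min_eq_left hxb, max_eq_right hxb] at ht
      exact hasDerivAt_arctanKernel_right ha hc hx ht.1)
    hf'
    (hint.congr_uIoo fun u hu ↦ by
      rw [uIoo_of_le hxb] at hu
      simp only
      rw [Real.sqrt_mul (x := u - a) (by linarith [hu.1]), div_div, mul_assoc])
  have h0 : arctanKernel a c x x = 0 := by simp [arctanKernel]
  rw [h0, mul_zero, sub_zero] at hparts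
  rw [← hparts, ← intervalIntegral.integral_const_mul]
  refine intervalIntegral.integral_congr fun t _ ↦ ?_
  generalize √(x * (x - a * c)) = P at hP ⊢
  field_simp

theorem regularKernel_mul_integral {a c t b M : ℝ} (ha : a < 0) (hc : 1 < c) (ht : 0 < t)
    (htb : t ≤ b) {g : ℝ → ℝ} (hg : Measurable g) (hM : ∀ u ∈ Icc t b, |g u| ≤ M) :
    ∫ u in t..b, regularKernel a c t u * g u / √(u - t) =
      √(t / (t - a * c)) * ((∫ u in t..b, √(u - a) * g u / ((t - c * u) * √(u - t))) +
        (a / (t * (t - a))) * ∫ u in t..b, √(u - a) * g u / √(u - t)) := by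
  have hne : ∀ u ∈ Icc t b, t - c * u ≠ 0 := fun u hu ↦ by nlinarith [hu.1]
  have hta : t - a ≠ 0 := by linarith
  obtain ⟨C₁, hC₁⟩ := isCompact_Icc.exists_bound_of_continuousOn
    (ContinuousOn.div (f := fun u ↦ √(u - a)) (by fun_prop) (by fun_prop) hne)
  obtain ⟨C₂, hC₂⟩ := isCompact_Icc.exists_bound_of_continuousOn (s := Icc t b)
    (f := fun u ↦ √(u - a)) (by fun_prop)
  have h1 := intervalIntegrable_div_sqrt_sub_left (C := C₁ * M)
    (g := fun u ↦ √(u - a) / (t - c * u) * g u) htb (by fun_prop) fun u hu ↦ by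
      have hu := Ioc_subset_Icc_self hu
      rw [abs_mul]
      exact mul_le_mul (hC₁ u hu) (hM u hu) (abs_nonneg _) ((norm_nonneg _).trans (hC₁ u hu))
  have h2 := intervalIntegrable_div_sqrt_sub_left (C := C₂ * M)
    (g := fun u ↦ √(u - a) * g u) htb (by fun_prop) fun u hu ↦ by
      have hu := Ioc_subset_Icc_self hu
      rw [abs_mul]
      exact mul_le_mul (hC₂ u hu) (hM u hu) (abs_nonneg _) ((norm_nonneg _).trans (hC₂ u hu))
  have e1 : ∀ u, √(u - a) * g u / ((t - c * u) * √(u - t)) =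
      √(u - a) / (t - c * u) * g u / √(u - t) := fun u ↦ by rw [← div_div, div_mul_eq_mul_div]
  simp only [e1]
  rw [← intervalIntegral.integral_const_mul, ← intervalIntegral.integral_add h1 (h2.const_mul _),
    ← intervalIntegral.integral_const_mul]
  refine intervalIntegral.integral_congr fun u hu ↦ ?_
  rw [uIcc_of_le htb] at hu
  have := hne u hu
  simp only [regularKernel, ← mul_div_assoc, ← add_div]
  congr 1
  field_simp
  ring

theorem integral_div_sqrt_eq_integral_regularKernel {a c x b M : ℝ} (ha : a < 0) (hc : 1 < c)
    (hx : 0 < x) (hxb : x ≤ b) {f : ℝ → ℝ} (hf : ∀ t ∈ Icc x b, DifferentiableAt ℝ f t)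
    (hM : ∀ t ∈ Icc x b, |deriv f t| ≤ M) :
    ∫ t in x..b, f t / ((x - c * t) * √((t - a) * (t - x))) =
      (√(x * (x - a * c)))⁻¹ * ∫ t in x..b, √(t / (t - a * c)) *
        ((t ^ 2 - a * c * b) * √(b - a) * f b / (t * (t - a) * (t - c * b) * √(b - t))
          - (∫ u in t..b, √(u - a) * deriv f u / ((t - c * u) * √(u - t)))
          - (a / (t * (t - a))) * ∫ u in t..b, √(u - a) * deriv f u / √(u - t)) := by
  have hmeas : Measurable (deriv f) := measurable_deriv f
  have hf' : IntervalIntegrable (deriv f) volume x b := by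
    refine (intervalIntegrable_const (c := M)).mono_fun' hmeas.aestronglyMeasurable ?_
    rw [uIoc_of_le hxb]
    filter_upwards [self_mem_ae_restrict measurableSet_Ioc] with u hu
    exact hM u (Ioc_subset_Icc_self hu)
  obtain ⟨C, hC⟩ := exists_abs_regularKernel_le ha hc hx b
  have hm : Measurable (Function.uncurry fun t u ↦ regularKernel a c t u * deriv f u) :=
    (measurable_regularKernel a c).mul (hmeas.comp measurable_snd)
  have hmC : ∀ t u, x < t → t < u → u ≤ b → |regularKernel a c t u * deriv f u| ≤ C * M := by
    intro t u h1 h2 h3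
    rw [abs_mul]
    have := hC t u h1.le h2.le h3
    exact mul_le_mul this (hM u ⟨(h1.trans h2).le, h3⟩) (abs_nonneg _) ((abs_nonneg _).trans this)
  rw [integral_div_sqrt_eq_arctanKernel ha hc hx hxb hf hf']
  congr 1
  calc f b * arctanKernel a c x b - ∫ u in x..b, deriv f u * arctanKernel a c x u
    _ = (∫ t in x..b, f b * (regularKernel a c t b / √(b - t))) -
        ∫ t in x..b, ∫ u in t..b, regularKernel a c t u * deriv f u / √(u - t) := by
      rw [integral_integral_swap_div_sqrt hxb hm hmC, intervalIntegral.integral_const_mul,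
        integral_regularKernel ha hc hx hxb]
      congr 1
      refine intervalIntegral.integral_congr fun u hu ↦ ?_
      rw [uIcc_of_le hxb] at hu
      simp only [← integral_regularKernel ha hc hx hu.1, ← intervalIntegral.integral_const_mul]
      congr 1 with t
      ring
    _ = _ := by
      rw [← intervalIntegral.integral_sub
        ((intervalIntegrable_regularKernel ha hc hx hxb).const_mul _)
        (intervalIntegrable_integral_div_sqrt hxb hm hmC)]
      refine intervalIntegral.integral_congr fun t ht ↦ ?_
      rw [uIcc_of_le hxb] at ht
      rw [regularKernel_mul_integral ha hc (hx.trans_le ht.1) ht.2 hmeas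
        fun u hu ↦ hM u ⟨ht.1.trans hu.1, hu.2⟩]
      rw [← div_div _ _ √(b - t), regularKernel]
      ring

/-- Lemma 4.4 (Convolution4): for `a < 0 < x`, `c > 1`, `ε > 0`, `x < 1 - ε`,
`a·c < x`, and `f` differentiable on `(a,1)` with locally bounded derivative,
`∫_x^{1-ε} f(t)/((x-ct)·√((t-a)(t-x))) dt = (1/√(x(x-ac))) ∫_x^{1-ε} √(t/(t-ac)) ·
  [ (t²-ac(1-ε))·√(1-a-ε)·f(1-ε)/(t(t-a)(t-c(1-ε))√(1-t-ε))
    - ∫_t^{1-ε} √(u-a)f'(u)/((t-cu)√(u-t)) du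
    - (a/(t(t-a))) ∫_t^{1-ε} √(u-a)f'(u)/√(u-t) du ] dt`. -/
theorem stmt_3 (a c x ε : ℝ) (ha : a < 0) (hx0 : 0 < x) (hc : 1 < c)
    (hε0 : 0 < ε) (hx1 : x < 1 - ε) (hac : a * c < x) (f : ℝ → ℝ)
    (hdiff : ∀ t ∈ Set.Ioo a 1, DifferentiableAt ℝ f t)
    (hbdd : ∀ p q : ℝ, a < p → q < 1 →
      ∃ M : ℝ, ∀ t ∈ Set.Icc p q, |deriv f t| ≤ M) :
    (∫ t in x..(1 - ε), f t / ((x - c * t) * Real.sqrt ((t - a) * (t - x)))) =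
      (Real.sqrt (x * (x - a * c)))⁻¹ *
        ∫ t in x..(1 - ε), Real.sqrt (t / (t - a * c)) *
          ((t ^ 2 - a * c * (1 - ε)) * Real.sqrt (1 - a - ε) * f (1 - ε) /
              (t * (t - a) * (t - c * (1 - ε)) * Real.sqrt (1 - t - ε))
            - (∫ u in t..(1 - ε),
                Real.sqrt (u - a) * deriv f u / ((t - c * u) * Real.sqrt (u - t)))
            - (a / (t * (t - a))) *
                ∫ u in t..(1 - ε), Real.sqrt (u - a) * deriv f u / Real.sqrt (u - t)) := by
  obtain ⟨M, hM⟩ := hbdd x (1 - ε) (by linarith) (by linarith)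
  have h := integral_div_sqrt_eq_integral_regularKernel ha hc hx0 hx1.le
    (fun t ht ↦ hdiff t ⟨by linarith [ht.1], by linarith [ht.2]⟩) hM
  rw [h, sub_right_comm 1 a ε]
  simp only [sub_right_comm 1 _ ε]
end

section
/- Let a < 0 < x, c > 1, ε > 0 with x < 1 − ε and a·c < x, and let f : (a,1) → ℝ be differentiable with derivative bounded on every compact subinterval of (a,1). Then ∫_x^{1−ε} H_{w3}(x/t)·f(t)/((x−c·t)·√(t·(t−a))) dt = (1/√(x·(x−a·c))) · ∫_x^{1−ε} (1/√(t·(t−a·c))) · [ c·√((1−ε)(1−a−ε))·H_{w3}(t/(1−ε))·f(1−ε)/(t−c·(1−ε)) − c·∫_t^{1−ε} √(u·(u−a))·H_{w3}(t/u)·f′(u)/(t−c·u) du + ∫_t^{1−ε} f(u)/√((u−a)(u−t)) du ] dt. -/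
/-- The weight-one iterated integral `H_{w₃}(y) = ∫_y^1 dt/(t·√(1-t))`. -/
noncomputable def Hw3 (y : ℝ) : ℝ := ∫ t in y..1, (t * Real.sqrt (1 - t))⁻¹

open MeasureTheory Set

/-- The closed triangle `x ≤ t ≤ u ≤ b`. -/
def triangle (x b : ℝ) : Set (ℝ × ℝ) := {p | x ≤ p.1 ∧ p.1 ≤ p.2 ∧ p.2 ≤ b}

lemma isCompact_triangle (x b : ℝ) : IsCompact (triangle x b) := by
  refine (isCompact_Icc (a := ((x, x) : ℝ × ℝ)) (b := (b, b))).of_isClosed_subset ?_ ?_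
  · exact (isClosed_le continuous_const continuous_fst).inter
      ((isClosed_le continuous_fst continuous_snd).inter
        (isClosed_le continuous_snd continuous_const))
  · rintro ⟨t, u⟩ ⟨h1, h2, h3⟩
    simp only at h1 h2 h3
    exact ⟨⟨h1, h1.trans h2⟩, ⟨h2.trans h3, h3⟩⟩

lemma integrableOn_inv_sqrt (l : ℝ) : IntegrableOn (fun s : ℝ => (√s)⁻¹) (Icc 0 l) := by
  rcases lt_or_ge l 0 with h | h
  · simp [Icc_eq_empty (not_le.2 h)]
  have h1 : IntervalIntegrable (fun s : ℝ => s ^ (-(1 / 2) : ℝ)) volume 0 l :=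
    intervalIntegral.intervalIntegrable_rpow' (by norm_num)
  rw [integrableOn_Icc_iff_integrableOn_Ioc]
  rw [intervalIntegrable_iff_integrableOn_Ioc_of_le h] at h1
  refine h1.congr_fun (fun s hs => ?_) measurableSet_Ioc
  simp only
  rw [Real.rpow_neg hs.1.le, Real.sqrt_eq_rpow]

/-- A function continuous on the triangle times `1/√(u-t)` is integrable there. -/
lemma integrableOn_triangle {x b : ℝ} {E : ℝ × ℝ → ℝ} (hE : ContinuousOn E (triangle x b)) :
    IntegrableOn (fun p : ℝ × ℝ => E p * (√(p.2 - p.1))⁻¹) (triangle x b) := by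
  have hm : MeasurableSet (triangle x b) := (isCompact_triangle x b).measurableSet
  obtain ⟨M, hM⟩ := (isCompact_triangle x b).exists_bound_of_continuousOn hE
  have h1 : Integrable ((Icc x b).indicator (fun _ : ℝ => (1 : ℝ))) :=
    (integrable_indicator_iff measurableSet_Icc).2 (by simp)
  have h2 : Integrable ((Icc 0 (b - x)).indicator (fun s : ℝ => (√s)⁻¹)) :=
    (integrable_indicator_iff measurableSet_Icc).2 (integrableOn_inv_sqrt _)
  have h3 := (h1.convolution_integrand (ContinuousLinearMap.mul ℝ ℝ) h2).swap
  have h4 := ((h3.const_mul M).integrableOn (s := triangle x b))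
  refine Integrable.mono' h4 ?_ ?_
  · refine (hE.aestronglyMeasurable hm).mul ?_
    exact (by fun_prop : Measurable fun p : ℝ × ℝ => (√(p.2 - p.1))⁻¹).aestronglyMeasurable
  · refine (ae_restrict_iff' hm).2 (Filter.Eventually.of_forall ?_)
    rintro ⟨t, u⟩ hp
    have hb := hM _ hp
    obtain ⟨h1, h2, h3⟩ := hp
    simp only at h1 h2 h3
    have m1 : t ∈ Icc x b := ⟨h1, h2.trans h3⟩
    have m2 : u - t ∈ Icc 0 (b - x) := ⟨by linarith, by linarith⟩
    simp only [Function.comp, Prod.fst_swap, Prod.snd_swap, indicator_of_mem m1,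
      indicator_of_mem m2, ContinuousLinearMap.mul_apply', one_mul, norm_mul, norm_inv,
      Real.norm_of_nonneg (Real.sqrt_nonneg _)]
    gcongr

lemma integral_triangle_swap {x b : ℝ} (hxb : x ≤ b) {E : ℝ × ℝ → ℝ}
    (hE : ContinuousOn E (triangle x b)) :
    ∫ t in x..b, ∫ u in t..b, E (t, u) * (√(u - t))⁻¹ =
      ∫ u in x..b, ∫ t in x..u, E (t, u) * (√(u - t))⁻¹ := by
  have hm : MeasurableSet (triangle x b) := (isCompact_triangle x b).measurableSet
  set k : ℝ → ℝ → ℝ := fun t u => E (t, u) * (√(u - t))⁻¹ with hk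
  set F : ℝ → ℝ → ℝ := fun t u => (triangle x b).indicator (fun p => k p.1 p.2) (t, u) with hF
  have hint : Integrable (Function.uncurry F) (volume.prod volume) :=
    (integrable_indicator_iff hm).2 (integrableOn_triangle hE)
  have h1 : ∀ t ∈ Ioc x b, ∫ u in t..b, k t u = ∫ u, F t u := by
    intro t ht
    rw [intervalIntegral.integral_of_le ht.2, ← integral_Icc_eq_integral_Ioc,
      ← integral_indicator measurableSet_Icc]
    congr 1 with u
    simp only [hF, indicator, triangle, mem_Icc, mem_ofPred_eq]
    simp [ht.1.le]
  have h2 : ∀ u ∈ Ioc x b, ∫ t in x..u, k t u = ∫ t, F t u := by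
    intro u hu
    rw [intervalIntegral.integral_of_le hu.1.le, ← integral_Icc_eq_integral_Ioc,
      ← integral_indicator measurableSet_Icc]
    congr 1 with t
    simp only [hF, indicator, triangle, mem_Icc, mem_ofPred_eq]
    simp [hu.2]
  have h3 : ∀ t ∉ Icc x b, ∫ u, F t u = 0 := by
    intro t ht
    rw [← integral_zero ℝ ℝ]
    congr 1 with u
    refine indicator_of_notMem (fun h => ht ⟨h.1, h.2.1.trans h.2.2⟩) _
  have h4 : ∀ u ∉ Icc x b, ∫ t, F t u = 0 := by
    intro u hu
    rw [← integral_zero ℝ ℝ]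
    congr 1 with t
    refine indicator_of_notMem (fun h => hu ⟨h.1.trans h.2.1, h.2.2⟩) _
  rw [intervalIntegral.integral_of_le hxb, intervalIntegral.integral_of_le hxb,
    setIntegral_congr_fun measurableSet_Ioc h1, setIntegral_congr_fun measurableSet_Ioc h2,
    ← integral_Icc_eq_integral_Ioc, ← integral_Icc_eq_integral_Ioc,
    setIntegral_eq_integral_of_forall_compl_eq_zero h3,
    setIntegral_eq_integral_of_forall_compl_eq_zero h4]
  exact integral_integral_swap hint

lemma intervalIntegrable_inv_sqrt_sub_left (t b : ℝ) (h : t ≤ b) :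
    IntervalIntegrable (fun u => (√(u - t))⁻¹) volume t b := by
  have h1 : IntervalIntegrable (fun s : ℝ => (√s)⁻¹) volume 0 (b - t) := by
    rw [intervalIntegrable_iff_integrableOn_Ioc_of_le (by linarith)]
    exact (integrableOn_inv_sqrt _).mono_set Ioc_subset_Icc_self
  simpa using h1.comp_sub_right t

lemma intervalIntegrable_inv_sqrt_sub_right (x u : ℝ) (h : x ≤ u) :
    IntervalIntegrable (fun t => (√(u - t))⁻¹) volume x u := by
  have h1 : IntervalIntegrable (fun s : ℝ => (√s)⁻¹) volume 0 (u - x) := by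
    rw [intervalIntegrable_iff_integrableOn_Ioc_of_le (by linarith)]
    exact (integrableOn_inv_sqrt _).mono_set Ioc_subset_Icc_self
  simpa using (h1.comp_sub_left u).symm

/-- `log ((1 + √(1-y)) / (1 - √(1-y))) = 2 artanh √(1-y)`, an explicit form of `Hw3` on `(0,1]`. -/
noncomputable def logHw3 (y : ℝ) : ℝ := Real.log (1 + √(1 - y)) - Real.log (1 - √(1 - y))

lemma sqrt_one_sub_lt_one {y : ℝ} (hy : 0 < y) : √(1 - y) < 1 := by
  rw [Real.sqrt_lt' one_pos]; linarith

lemma continuousOn_logHw3 : ContinuousOn logHw3 (Ioi 0) := by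
  have hs : ContinuousOn (fun y : ℝ => √(1 - y)) (Ioi 0) := by fun_prop
  refine ((continuousOn_const.add hs).log fun y _ => ?_).sub
    ((continuousOn_const.sub hs).log fun y hy => ?_)
  · exact (by positivity : 0 < 1 + √(1 - y)).ne'
  · exact (sub_pos.2 (sqrt_one_sub_lt_one hy)).ne'

lemma hasDerivAt_logHw3 {y : ℝ} (hy0 : 0 < y) (hy1 : y < 1) :
    HasDerivAt logHw3 (-(y * √(1 - y))⁻¹) y := by
  have hpos : 0 < √(1 - y) := Real.sqrt_pos.2 (by linarith)
  have hlt := sqrt_one_sub_lt_one hy0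
  have hsq : √(1 - y) ^ 2 = 1 - y := Real.sq_sqrt (by linarith)
  have hs : HasDerivAt (fun y : ℝ => √(1 - y)) (-1 / (2 * √(1 - y))) y :=
    ((hasDerivAt_id' y).const_sub 1).sqrt (by linarith)
  have h := ((hs.const_add 1).log (by positivity)).sub ((hs.const_sub 1).log (by linarith))
  refine h.congr_deriv ?_
  have h1 : 1 - √(1 - y) ≠ 0 := by linarith
  have hy : y = (1 - √(1 - y)) * (1 + √(1 - y)) := by linear_combination hsq
  have h2 : (y * √(1 - y))⁻¹ = ((1 - √(1 - y)) * (1 + √(1 - y)) * √(1 - y))⁻¹ := by rw [← hy]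
  rw [h2]
  have h3 : 1 + √(1 - y) ≠ 0 := by positivity
  generalize √(1 - y) = s at *
  field_simp
  ring

lemma Hw3_eq_logHw3 {y : ℝ} (hy0 : 0 < y) (hy1 : y ≤ 1) : Hw3 y = logHw3 y := by
  have hc : ContinuousOn (fun t => -logHw3 t) (Icc y 1) :=
    (continuousOn_logHw3.mono fun t ht => hy0.trans_le ht.1).neg
  have hd : ∀ t ∈ Ioo y 1, HasDerivAt (fun t => -logHw3 t) (t * √(1 - t))⁻¹ t := fun t ht => by
    simpa using (hasDerivAt_logHw3 (hy0.trans ht.1) ht.2).fun_neg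
  have hi := intervalIntegral.integrableOn_deriv_of_nonneg hc hd fun t ht => by
    have := hy0.trans ht.1
    positivity
  rw [Hw3, intervalIntegral.integral_eq_sub_of_hasDerivAt_of_le hy1 hc hd
    ((intervalIntegrable_iff_integrableOn_Ioc_of_le hy1).2 hi)]
  simp [logHw3]

lemma sqrt_one_sub_div {t u : ℝ} (hu : 0 < u) : √(1 - t / u) = √(u - t) / √u := by
  rw [← Real.sqrt_div' _ hu.le]
  congr 1
  field_simp

lemma hasDerivAt_logHw3_div_right {t u : ℝ} (ht : 0 < t) (htu : t < u) :
    HasDerivAt (fun u => logHw3 (t / u)) (√u * √(u - t))⁻¹ u := by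
  have hu : 0 < u := ht.trans htu
  have h := (hasDerivAt_logHw3 (div_pos ht hu) ((div_lt_one hu).2 htu)).comp u
    ((hasDerivAt_const u t).fun_div (hasDerivAt_id' u) hu.ne')
  refine h.congr_deriv ?_
  have hs : 0 < √(u - t) := Real.sqrt_pos.2 (by linarith)
  have hr : 0 < √u := Real.sqrt_pos.2 hu
  have hr2 : √u ^ 2 = u := Real.sq_sqrt hu.le
  rw [sqrt_one_sub_div hu]
  field_simp
  rw [hr2]
  ring

lemma hasDerivAt_logHw3_div_left {t u : ℝ} (ht : 0 < t) (htu : t < u) :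
    HasDerivAt (fun t => logHw3 (t / u)) (-(√u / (t * √(u - t)))) t := by
  have hu : 0 < u := ht.trans htu
  have h := (hasDerivAt_logHw3 (div_pos ht hu) ((div_lt_one hu).2 htu)).comp t
    ((hasDerivAt_id' t).div_const u)
  refine h.congr_deriv ?_
  have hs : 0 < √(u - t) := Real.sqrt_pos.2 (by linarith)
  have hr : 0 < √u := Real.sqrt_pos.2 hu
  rw [sqrt_one_sub_div hu]
  field_simp

/-- `√(u-t)` times the derivative in `u` of `√(u(u-a)) H(t/u) / (t - cu)`. -/
noncomputable def derivRightNum (a c : ℝ) (p : ℝ × ℝ) : ℝ :=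
  ((2 * p.2 - a) / (2 * √(p.2 * (p.2 - a)) * (p.1 - c * p.2))
      + c * √(p.2 * (p.2 - a)) / (p.1 - c * p.2) ^ 2) * logHw3 (p.1 / p.2) * √(p.2 - p.1)
    + √(p.2 - a) / (p.1 - c * p.2)

lemma sub_mul_neg_of_one_lt {c t u : ℝ} (hc : 1 < c) (ht : 0 < t) (htu : t ≤ u) : t - c * u < 0 := by
  nlinarith

lemma hasDerivAt_right {a c t u : ℝ} (ha : a < 0) (hc : 1 < c) (ht : 0 < t) (htu : t < u) :
    HasDerivAt (fun u => √(u * (u - a)) * logHw3 (t / u) / (t - c * u))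
      (derivRightNum a c (t, u) * (√(u - t))⁻¹) u := by
  have hu : 0 < u := ht.trans htu
  have hua : 0 < u - a := by linarith
  have hd : t - c * u ≠ 0 := (sub_mul_neg_of_one_lt hc ht htu.le).ne
  have h1 : HasDerivAt (fun u => √(u * (u - a))) ((2 * u - a) / (2 * √(u * (u - a)))) u := by
    refine (((hasDerivAt_id' u).fun_mul ((hasDerivAt_id' u).sub_const a)).sqrt
      (by positivity)).congr_deriv ?_
    ring_nf
  have h2 : HasDerivAt (fun u => t - c * u) (-c) u := by
    simpa using ((hasDerivAt_id' u).const_mul c).const_sub t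
  refine ((h1.fun_mul (hasDerivAt_logHw3_div_right ht htu)).fun_div h2 hd).congr_deriv ?_
  have hs : 0 < √(u - t) := Real.sqrt_pos.2 (by linarith)
  have hr : 0 < √u := Real.sqrt_pos.2 hu
  have hw : 0 < √(u - a) := Real.sqrt_pos.2 hua
  simp only [derivRightNum, Real.sqrt_mul hu.le]
  field_simp
  ring

lemma hasDerivAt_left {a c t u : ℝ} (ha : a < 0) (hc : 1 < c) (ht : 0 < t) (htac : a * c < t)
    (htu : t < u) :
    HasDerivAt
      (fun t => -(√(t * (t - a * c)) * logHw3 (t / u) / (t - c * u) / √(u * (u - a))))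
      ((√(t * (t - a * c)))⁻¹ * (c * derivRightNum a c (t, u) + (√(u - a))⁻¹) * (√(u - t))⁻¹)
      t := by
  have hu : 0 < u := ht.trans htu
  have hua : 0 < u - a := by linarith
  have hta : 0 < t - a * c := by linarith
  have hd : t - c * u ≠ 0 := (sub_mul_neg_of_one_lt hc ht htu.le).ne
  have h1 : HasDerivAt (fun t => √(t * (t - a * c)))
      ((2 * t - a * c) / (2 * √(t * (t - a * c)))) t := by
    refine (((hasDerivAt_id' t).fun_mul ((hasDerivAt_id' t).sub_const (a * c))).sqrt
      (by positivity)).congr_deriv ?_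
    ring_nf
  have h2 : HasDerivAt (fun t => t - c * u) 1 t := (hasDerivAt_id' t).sub_const _
  refine ((((h1.fun_mul (hasDerivAt_logHw3_div_left ht htu)).fun_div h2 hd).div_const
    (√(u * (u - a)))).fun_neg).congr_deriv ?_
  have hs : 0 < √(u - t) := Real.sqrt_pos.2 (by linarith)
  have hr : 0 < √u := Real.sqrt_pos.2 hu
  have hw : 0 < √(u - a) := Real.sqrt_pos.2 hua
  have hq : 0 < √t := Real.sqrt_pos.2 ht
  have hv : 0 < √(t - a * c) := Real.sqrt_pos.2 hta
  have hr2 : √u ^ 2 = u := Real.sq_sqrt hu.le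
  have hw2 : √(u - a) ^ 2 = u - a := Real.sq_sqrt hua.le
  have hq2 : √t ^ 2 = t := Real.sq_sqrt ht.le
  have hv2 : √(t - a * c) ^ 2 = t - a * c := Real.sq_sqrt hta.le
  simp only [derivRightNum, Real.sqrt_mul hu.le, Real.sqrt_mul ht.le]
  generalize √(u - t) = s at *
  generalize √u = r at *
  generalize √(u - a) = w at *
  generalize √t = q at *
  generalize √(t - a * c) = v at *
  generalize logHw3 (t / u) = P at *
  field_simp
  rw [hr2, hw2, hq2, hv2]
  ring

lemma continuousOn_derivRightNum {a c x b : ℝ} (ha : a < 0) (hc : 1 < c) (hx : 0 < x) :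
    ContinuousOn (derivRightNum a c) (triangle x b) := by
  have hP : ContinuousOn (fun p : ℝ × ℝ => logHw3 (p.1 / p.2)) (triangle x b) := by
    refine continuousOn_logHw3.comp (t := Ioi 0)
      (continuousOn_fst.div continuousOn_snd fun p hp => ?_) fun p hp => ?_
    · exact (hx.trans_le (hp.1.trans hp.2.1)).ne'
    · exact div_pos (hx.trans_le hp.1) (hx.trans_le (hp.1.trans hp.2.1))
  have hd : ∀ p ∈ triangle x b, p.1 - c * p.2 ≠ 0 := fun p hp =>
    (sub_mul_neg_of_one_lt hc (hx.trans_le hp.1) hp.2.1).ne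
  have hs : ∀ p ∈ triangle x b, √(p.2 * (p.2 - a)) ≠ 0 := fun p hp => by
    have h0 : 0 < p.2 := hx.trans_le (hp.1.trans hp.2.1)
    exact (Real.sqrt_pos.2 (mul_pos h0 (by linarith))).ne'
  unfold derivRightNum
  refine ContinuousOn.add (ContinuousOn.mul (ContinuousOn.mul (ContinuousOn.add ?_ ?_) hP) ?_) ?_
  · exact ContinuousOn.div (by fun_prop) (by fun_prop) fun p hp =>
      mul_ne_zero (mul_ne_zero two_ne_zero (hs p hp)) (hd p hp)
  · exact ContinuousOn.div (by fun_prop) (by fun_prop) fun p hp => pow_ne_zero 2 (hd p hp)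
  · fun_prop
  · exact ContinuousOn.div (by fun_prop) (by fun_prop) hd

lemma continuousOn_primitive_right {a c t b : ℝ} (hc : 1 < c) (ht : 0 < t) :
    ContinuousOn (fun u => √(u * (u - a)) * logHw3 (t / u) / (t - c * u)) (Icc t b) := by
  refine ContinuousOn.div (ContinuousOn.mul (by fun_prop) ?_) (by fun_prop) fun u hu =>
    (sub_mul_neg_of_one_lt hc ht hu.1).ne
  refine continuousOn_logHw3.comp (t := Ioi 0)
      (continuousOn_const.div continuousOn_id fun u hu => ?_) fun u hu => ?_
  · exact (ht.trans_le hu.1).ne'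
  · exact div_pos ht (ht.trans_le hu.1)

lemma integral_left {a c x u : ℝ} (ha : a < 0) (hc : 1 < c) (hx : 0 < x) (hac : a * c < x)
    (hxu : x ≤ u) :
    ∫ t in x..u, (√(t * (t - a * c)))⁻¹ * (c * derivRightNum a c (t, u) + (√(u - a))⁻¹) *
        (√(u - t))⁻¹ =
      √(x * (x - a * c)) * logHw3 (x / u) / (x - c * u) / √(u * (u - a)) := by
  have hu : 0 < u := hx.trans_le hxu
  have hcont : ContinuousOn
      (fun t => -(√(t * (t - a * c)) * logHw3 (t / u) / (t - c * u) / √(u * (u - a))))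
      (Icc x u) := by
    refine ((ContinuousOn.div (ContinuousOn.mul (by fun_prop) ?_) (by fun_prop) fun t ht =>
      (sub_mul_neg_of_one_lt hc (hx.trans_le ht.1) ht.2).ne).div_const _).fun_neg
    exact continuousOn_logHw3.comp (t := Ioi 0) (by fun_prop) fun t ht =>
      div_pos (hx.trans_le ht.1) hu
  have hcont' : ContinuousOn
      (fun t => (√(t * (t - a * c)))⁻¹ * (c * derivRightNum a c (t, u) + (√(u - a))⁻¹))
      (uIcc x u) := by
    rw [uIcc_of_le hxu]
    refine ContinuousOn.mul (ContinuousOn.inv₀ (by fun_prop) fun t ht => ?_)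
      ((continuousOn_const.mul ?_).add continuousOn_const)
    · exact (Real.sqrt_pos.2 (mul_pos (hx.trans_le ht.1) (by linarith [ht.1]))).ne'
    · exact (continuousOn_derivRightNum (b := u) ha hc hx).comp (by fun_prop)
        fun t ht => ⟨ht.1, ht.2, le_rfl⟩
  rw [intervalIntegral.integral_eq_sub_of_hasDerivAt_of_le hxu hcont
    (fun t ht => hasDerivAt_left ha hc (hx.trans ht.1) (hac.trans ht.1) ht.2)
    ((intervalIntegrable_inv_sqrt_sub_right x u hxu).continuousOn_mul hcont')]
  simp [div_self hu.ne', logHw3]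

/-- Integration by parts turns the boundary term and the `f'`-integral into one integral of `f`. -/
lemma integral_right {a c t b : ℝ} (ha : a < 0) (hc : 1 < c) (ht : 0 < t) (htb : t ≤ b)
    {f : ℝ → ℝ} (hf : ∀ u ∈ Icc t b, DifferentiableAt ℝ f u)
    (hf' : IntervalIntegrable (deriv f) volume t b) :
    c * √(b * (b - a)) * logHw3 (t / b) * f b / (t - c * b)
        - c * (∫ u in t..b, √(u * (u - a)) * logHw3 (t / u) * deriv f u / (t - c * u))
        + ∫ u in t..b, f u / √((u - a) * (u - t)) =
      ∫ u in t..b, (c * derivRightNum a c (t, u) + (√(u - a))⁻¹) * f u * (√(u - t))⁻¹ := by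
  have hfc : ContinuousOn f (uIcc t b) := by
    rw [uIcc_of_le htb]
    exact fun u hu => (hf u hu).continuousAt.continuousWithinAt
  have hN : ContinuousOn (fun u => derivRightNum a c (t, u)) (uIcc t b) := by
    rw [uIcc_of_le htb]
    exact (continuousOn_derivRightNum (b := b) ha hc ht).comp (by fun_prop)
      fun u hu => ⟨le_rfl, hu.1, hu.2⟩
  have hW : ContinuousOn (fun u => (√(u - a))⁻¹) (uIcc t b) := by
    rw [uIcc_of_le htb]
    exact ContinuousOn.inv₀ (by fun_prop) fun u hu =>
      (Real.sqrt_pos.2 (by linarith [hu.1])).ne'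
  have hI := intervalIntegrable_inv_sqrt_sub_left t b htb
  have hparts := intervalIntegral.integral_mul_deriv_eq_deriv_mul_of_hasDeriv_right
    (u := fun u => √(u * (u - a)) * logHw3 (t / u) / (t - c * u)) (v := f) (v' := deriv f)
    (u' := fun u => derivRightNum a c (t, u) * (√(u - t))⁻¹) (a := t) (b := b)
    (by rw [uIcc_of_le htb]; exact continuousOn_primitive_right hc ht) hfc
    (fun u hu => by
      rw [min_eq_left htb, max_eq_right htb] at hu
      exact (hasDerivAt_right ha hc ht hu.1).hasDerivWithinAt)
    (fun u hu => by
      rw [min_eq_left htb, max_eq_right htb] at hu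
      exact (hf u (Ioo_subset_Icc_self hu)).hasDerivAt.hasDerivWithinAt)
    (hI.continuousOn_mul hN) hf'
  have h0 : logHw3 (t / t) = 0 := by simp [div_self ht.ne', logHw3]
  have e1 : ∫ u in t..b, √(u * (u - a)) * logHw3 (t / u) * deriv f u / (t - c * u) =
      ∫ u in t..b, √(u * (u - a)) * logHw3 (t / u) / (t - c * u) * deriv f u := by
    congr 1 with u
    ring
  have e2 : ∫ u in t..b, f u / √((u - a) * (u - t)) =
      ∫ u in t..b, (√(u - a))⁻¹ * f u * (√(u - t))⁻¹ := by
    refine intervalIntegral.integral_congr fun u hu => ?_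
    rw [uIcc_of_le htb] at hu
    rw [Real.sqrt_mul (by linarith [hu.1]), div_eq_mul_inv, mul_inv]
    ring
  have e3 : ∫ u in t..b, (c * derivRightNum a c (t, u) + (√(u - a))⁻¹) * f u * (√(u - t))⁻¹ =
      c * (∫ u in t..b, derivRightNum a c (t, u) * (√(u - t))⁻¹ * f u) +
        ∫ u in t..b, (√(u - a))⁻¹ * f u * (√(u - t))⁻¹ := by
    rw [← intervalIntegral.integral_const_mul, ← intervalIntegral.integral_add]
    · congr 1 with u
      ring
    · exact ((hI.continuousOn_mul hN).mul_continuousOn hfc).const_mul c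
    · exact hI.continuousOn_mul (hW.mul hfc)
  rw [e1, e2, e3, hparts]
  simp only [h0]
  ring

/-- Lemma 4.5 (Convolution41i): for `a < 0 < x`, `c > 1`, `ε > 0`, `x < 1 - ε`,
`a·c < x`, and `f` differentiable on `(a,1)` with locally bounded derivative,
`∫_x^{1-ε} H_{w₃}(x/t)·f(t)/((x-ct)·√(t(t-a))) dt = (1/√(x(x-ac))) ∫_x^{1-ε} (1/√(t(t-ac))) ·
  [ c·√((1-ε)(1-a-ε))·H_{w₃}(t/(1-ε))·f(1-ε)/(t-c(1-ε))
    - c·∫_t^{1-ε} √(u(u-a))·H_{w₃}(t/u)·f'(u)/(t-cu) du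
    + ∫_t^{1-ε} f(u)/√((u-a)(u-t)) du ] dt`. -/
theorem stmt_4 (a c x ε : ℝ) (ha : a < 0) (hx0 : 0 < x) (hc : 1 < c)
    (hε0 : 0 < ε) (hx1 : x < 1 - ε) (hac : a * c < x) (f : ℝ → ℝ)
    (hdiff : ∀ t ∈ Set.Ioo a 1, DifferentiableAt ℝ f t)
    (hbdd : ∀ p q : ℝ, a < p → q < 1 →
      ∃ M : ℝ, ∀ t ∈ Set.Icc p q, |deriv f t| ≤ M) :
    (∫ t in x..(1 - ε),
        Hw3 (x / t) * f t / ((x - c * t) * Real.sqrt (t * (t - a)))) =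
      (Real.sqrt (x * (x - a * c)))⁻¹ *
        ∫ t in x..(1 - ε), (Real.sqrt (t * (t - a * c)))⁻¹ *
          (c * Real.sqrt ((1 - ε) * (1 - a - ε)) * Hw3 (t / (1 - ε)) * f (1 - ε) /
              (t - c * (1 - ε))
            - c * (∫ u in t..(1 - ε),
                Real.sqrt (u * (u - a)) * Hw3 (t / u) * deriv f u / (t - c * u))
            + ∫ u in t..(1 - ε), f u / Real.sqrt ((u - a) * (u - t))) := by
  set b := 1 - ε with hb
  have hab : 1 - a - ε = b - a := by rw [hb]; ring
  have hb1 : b < 1 := by linarith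
  have hfd : ∀ u ∈ Set.Icc x b, DifferentiableAt ℝ f u := fun u hu =>
    hdiff u ⟨by linarith [hu.1], by linarith [hu.2]⟩
  have hf' : IntervalIntegrable (deriv f) volume x b := by
    obtain ⟨M, hM⟩ := hbdd x b (by linarith) hb1
    refine (intervalIntegrable_const (c := M)).mono_fun'
      (measurable_deriv f).aestronglyMeasurable ?_
    rw [uIoc_of_le hx1.le]
    exact (ae_restrict_iff' measurableSet_Ioc).2
      (Filter.Eventually.of_forall fun u hu => hM u (Ioc_subset_Icc_self hu))
  have hE : ContinuousOn (fun p : ℝ × ℝ => (√(p.1 * (p.1 - a * c)))⁻¹ *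
      ((c * derivRightNum a c p + (√(p.2 - a))⁻¹) * f p.2)) (triangle x b) := by
    refine ContinuousOn.mul (ContinuousOn.inv₀ (by fun_prop) fun p hp => ?_)
      (((continuousOn_const.mul (continuousOn_derivRightNum ha hc hx0)).add
        (ContinuousOn.inv₀ (by fun_prop) fun p hp => ?_)).mul ?_)
    · exact (Real.sqrt_pos.2 (mul_pos (hx0.trans_le hp.1) (by linarith [hp.1]))).ne'
    · exact (Real.sqrt_pos.2 (by linarith [hp.1, hp.2.1])).ne'
    · exact ContinuousOn.comp (t := Icc x b)
        (fun u hu => (hfd u hu).continuousAt.continuousWithinAt) continuousOn_snd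
        fun p hp => ⟨hp.1.trans hp.2.1, hp.2.2⟩
  have hinner : ∀ t ∈ uIcc x b, (√(t * (t - a * c)))⁻¹ *
      (c * √(b * (1 - a - ε)) * Hw3 (t / b) * f b / (t - c * b)
        - c * (∫ u in t..b, √(u * (u - a)) * Hw3 (t / u) * deriv f u / (t - c * u))
        + ∫ u in t..b, f u / √((u - a) * (u - t))) =
      ∫ u in t..b, (√(t * (t - a * c)))⁻¹ *
        ((c * derivRightNum a c (t, u) + (√(u - a))⁻¹) * f u) * (√(u - t))⁻¹ := by
    intro t ht
    rw [uIcc_of_le hx1.le] at ht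
    have ht0 : 0 < t := hx0.trans_le ht.1
    have hH : ∫ u in t..b, √(u * (u - a)) * Hw3 (t / u) * deriv f u / (t - c * u) =
        ∫ u in t..b, √(u * (u - a)) * logHw3 (t / u) * deriv f u / (t - c * u) := by
      refine intervalIntegral.integral_congr fun u hu => ?_
      rw [uIcc_of_le ht.2] at hu
      have hu0 : 0 < u := ht0.trans_le hu.1
      rw [Hw3_eq_logHw3 (div_pos ht0 hu0) ((div_le_one hu0).2 hu.1)]
    have hb0 : 0 < b := ht0.trans_le ht.2
    rw [hH, Hw3_eq_logHw3 (div_pos ht0 hb0) ((div_le_one hb0).2 ht.2), hab,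
      integral_right ha hc ht0 ht.2 (fun u hu => hfd u ⟨ht.1.trans hu.1, hu.2⟩)
        (hf'.mono_set (uIcc_subset_uIcc (by rwa [uIcc_of_le hx1.le]) right_mem_uIcc)),
      ← intervalIntegral.integral_const_mul]
    congr 1 with u
    ring
  rw [intervalIntegral.integral_congr hinner, integral_triangle_swap hx1.le hE,
    ← intervalIntegral.integral_const_mul]
  refine intervalIntegral.integral_congr fun u hu => ?_
  rw [uIcc_of_le hx1.le] at hu
  have hu0 : 0 < u := hx0.trans_le hu.1
  have hsq : 0 < √(x * (x - a * c)) := Real.sqrt_pos.2 (mul_pos hx0 (by linarith))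
  have hfu : ∫ t in x..u, (√(t * (t - a * c)))⁻¹ *
      ((c * derivRightNum a c (t, u) + (√(u - a))⁻¹) * f u) * (√(u - t))⁻¹ =
      f u * (√(x * (x - a * c)) * logHw3 (x / u) / (x - c * u) / √(u * (u - a))) := by
    rw [← integral_left ha hc hx0 hac hu.1, ← intervalIntegral.integral_const_mul]
    congr 1 with t
    ring
  simp only
  rw [hfu, Hw3_eq_logHw3 (div_pos hx0 hu0) ((div_le_one hu0).2 hu.1)]
  generalize √(x * (x - a * c)) = s at hsq ⊢
  field_simp
end

section
/- For every real c > 1 and every x with 0 < x < 1 the following two identities hold: (i) ∫_x^1 H_{w3}(x/t)/((x−c·t)·√(t·(1−t))) dt = −(π/√(x·(c−x)))·∫_x^1 dt/√(t·(c−t)); (ii) ∫_x^1 t·H_{w3}(x/t)/((x−c·t)·√(t·(1−t))) dt = −(π/c)·( −ln(x) + √(x/(c−x))·∫_x^1 dt/√(t·(c−t)) ). -/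
open Set MeasureTheory Filter Topology

lemma intervalIntegrable_inv_sqrt_one_sub {x : ℝ} (hx : x < 1) :
    IntervalIntegrable (fun t => (√(1 - t))⁻¹) volume x 1 := by
  refine intervalIntegral.intervalIntegrable_deriv_of_nonneg (g := fun t => -(2 * √(1 - t)))
    (by fun_prop) (fun t ht => ?_) (fun t _ => by positivity)
  rw [min_eq_left hx.le, max_eq_right hx.le] at ht
  have hq : 0 < √(1 - t) := Real.sqrt_pos.2 (by linarith [ht.2])
  have h := ((((hasDerivAt_id t).const_sub 1).sqrt (by simp; linarith [ht.2])).const_mul 2).neg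
  refine h.congr_deriv ?_
  simp only [id]
  field_simp

lemma intervalIntegrable_inv_sqrt_one_sub_mul {x : ℝ} (hx : x < 1) {g : ℝ → ℝ}
    (hg : ContinuousOn g (Icc x 1)) :
    IntervalIntegrable (fun t => (√(1 - t))⁻¹ * g t) volume x 1 :=
  (intervalIntegrable_inv_sqrt_one_sub hx).mul_continuousOn (by rwa [uIcc_of_le hx.le])

/-- The integral `∫_x^1 √((t-x)/(1-t)) dt/(t-z) = π (1 - √((x-z)/(1-z)))`. -/
lemma integral_sqrt_div_sub {x z r : ℝ} (hx : x < 1) (hz : z < x) (hr : 0 < r)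
    (hrz : r ^ 2 * (1 - z) = x - z) :
    ∫ t in x..1, (√(1 - t))⁻¹ * (√(t - x) / (t - z)) = Real.pi * (1 - r) := by
  have hcont : ContinuousOn (fun t => √(t - x) / (t - z)) (Icc x 1) :=
    ContinuousOn.div (by fun_prop) (by fun_prop) fun t ht => by linarith [ht.1]
  have hv : Tendsto (fun t => √(t - x) / √(1 - t)) (𝓝[<] 1) atTop := by
    have h1 : Tendsto (fun t => √(t - x)) (𝓝[<] 1) (𝓝 √(1 - x)) :=
      (Continuous.tendsto (by fun_prop) 1).mono_left nhdsWithin_le_nhds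
    have h2 : Tendsto (fun t => √(1 - t)) (𝓝[<] 1) (𝓝[>] 0) := by
      refine tendsto_nhdsWithin_iff.2 ⟨?_, ?_⟩
      · have : Tendsto (fun t : ℝ => √(1 - t)) (𝓝 1) (𝓝 √(1 - 1)) :=
          Continuous.tendsto (by fun_prop) 1
        simpa using this.mono_left nhdsWithin_le_nhds
      · filter_upwards [self_mem_nhdsWithin] with t ht
        exact Real.sqrt_pos.2 (sub_pos.2 ht)
    simpa only [div_eq_mul_inv, Function.comp_def] using
      h1.pos_mul_atTop (Real.sqrt_pos.2 (sub_pos.2 hx)) (tendsto_inv_nhdsGT_zero.comp h2)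
  have key := intervalIntegral.integral_eq_sub_of_hasDerivAt_of_tendsto hx
    (f := fun t => 2 * Real.arctan (√(t - x) / √(1 - t)) -
      2 * r * Real.arctan (√(t - x) / √(1 - t) / r))
    (f' := fun t => (√(1 - t))⁻¹ * (√(t - x) / (t - z))) (fa := 0)
    (fb := 2 * (Real.pi / 2) - 2 * r * (Real.pi / 2)) ?_
    (intervalIntegrable_inv_sqrt_one_sub_mul hx hcont) ?_ ?_
  · rw [key]; ring
  · intro t ht
    have hp : 0 < √(t - x) := Real.sqrt_pos.2 (sub_pos.2 ht.1)
    have hq : 0 < √(1 - t) := Real.sqrt_pos.2 (sub_pos.2 ht.2)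
    have hp2 : √(t - x) ^ 2 = t - x := Real.sq_sqrt (sub_pos.2 ht.1).le
    have hq2 : √(1 - t) ^ 2 = 1 - t := Real.sq_sqrt (sub_pos.2 ht.2).le
    have hp' := ((hasDerivAt_id t).sub_const x).sqrt (sub_pos.2 ht.1).ne'
    have hq' := ((hasDerivAt_id t).const_sub 1).sqrt (sub_pos.2 ht.2).ne'
    have hv' := hp'.div hq' hq.ne'
    have h := (hv'.arctan.const_mul 2).sub ((hv'.div_const r).arctan.const_mul (2 * r))
    refine h.congr_deriv ?_
    simp only [id, Pi.div_apply]
    generalize √(t - x) = p at *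
    generalize √(1 - t) = q at *
    have htz : 0 < t - z := by linarith [ht.1]
    have h1z : 0 < 1 - z := by linarith
    have h1x : 0 < 1 - x := by linarith
    have e1 : 1 + (p / q) ^ 2 = (1 - x) / q ^ 2 := by
      field_simp; linarith
    have e2 : 1 + (p / q / r) ^ 2 = (1 - x) * (t - z) / ((1 - z) * q ^ 2 * r ^ 2) := by
      field_simp
      rw [hp2, hq2]; linear_combination (1 - t) * hrz
    have e3 : (1 / (2 * p) * q - p * (-1 / (2 * q))) / q ^ 2 = (1 - x) / (2 * p * q ^ 3) := by
      field_simp; linarith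
    rw [e1, e2, e3]
    field_simp
    rw [hp2]
    linear_combination -hrz
  · have : Tendsto (fun t => 2 * Real.arctan (√(t - x) / √(1 - t)) -
        2 * r * Real.arctan (√(t - x) / √(1 - t) / r)) (𝓝 x)
        (𝓝 (2 * Real.arctan (√(x - x) / √(1 - x)) -
        2 * r * Real.arctan (√(x - x) / √(1 - x) / r))) := by
      have hv : Tendsto (fun t => √(t - x) / √(1 - t)) (𝓝 x) (𝓝 (√(x - x) / √(1 - x))) :=
        ContinuousAt.div (by fun_prop) (by fun_prop) (Real.sqrt_pos.2 (sub_pos.2 hx)).ne'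
      have ha := fun y => Real.continuous_arctan.tendsto y
      exact (((ha _).comp hv).const_mul 2).sub
        (((ha _).comp (hv.div_const r)).const_mul (2 * r))
    simpa using this.mono_left nhdsWithin_le_nhds
  · have ha := Real.tendsto_arctan_atTop.mono_right nhdsWithin_le_nhds
    exact ((ha.comp hv).const_mul 2).sub
      ((ha.comp (hv.atTop_div_const hr)).const_mul (2 * r))

lemma Hw3_eq_log {y : ℝ} (hy0 : 0 < y) (hy1 : y < 1) :
    Hw3 y = Real.log (1 + √(1 - y)) - Real.log (1 - √(1 - y)) := by
  have hlt : ∀ t, 0 < t → √(1 - t) < 1 := fun t ht => by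
    rw [Real.sqrt_lt' one_pos]; linarith
  have hcont : ContinuousOn (fun t => Real.log (1 - √(1 - t)) - Real.log (1 + √(1 - t)))
      (Icc y 1) := by
    refine ContinuousOn.sub (ContinuousOn.log (by fun_prop) fun t ht => ?_)
      (ContinuousOn.log (by fun_prop) fun t ht => by positivity)
    linarith [hlt t (hy0.trans_le ht.1)]
  have hderiv : ∀ t ∈ Ioo y 1,
      HasDerivAt (fun t => Real.log (1 - √(1 - t)) - Real.log (1 + √(1 - t)))
        (t * √(1 - t))⁻¹ t := by
    intro t ht
    have hq : 0 < √(1 - t) := Real.sqrt_pos.2 (sub_pos.2 ht.2)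
    have hq1 := hlt t (hy0.trans ht.1)
    have hq2 : √(1 - t) ^ 2 = 1 - t := Real.sq_sqrt (sub_pos.2 ht.2).le
    have hq' := ((hasDerivAt_id t).const_sub 1).sqrt (sub_pos.2 ht.2).ne'
    have h := ((hq'.const_sub 1).log (by simp only [id]; linarith)).sub
      ((hq'.const_add 1).log (by simp only [id]; linarith))
    refine h.congr_deriv ?_
    simp only [id]
    have ht' : t = (1 - √(1 - t)) * (1 + √(1 - t)) := by linear_combination hq2
    generalize √(1 - t) = q at *
    have : 0 < 1 - q := by linarith
    rw [ht']
    field_simp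
    ring
  rw [Hw3, intervalIntegral.integral_eq_sub_of_hasDerivAt_of_le hy1.le hcont hderiv]
  · simp
  · refine intervalIntegral.intervalIntegrable_deriv_of_nonneg
      (by rwa [uIcc_of_le hy1.le]) ?_ ?_
    · rwa [min_eq_left hy1.le, max_eq_right hy1.le]
    · rw [min_eq_left hy1.le, max_eq_right hy1.le]
      intro t ht
      have := hy0.trans ht.1
      positivity

lemma integral_two_mul_div_one_sub_sq {k : ℝ} (hk0 : 0 ≤ k) (hk1 : k < 1) :
    ∫ s in (0 : ℝ)..1, 2 * k / (1 - k ^ 2 * s ^ 2) = Real.log (1 + k) - Real.log (1 - k) := by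
  have hpos : ∀ s ∈ uIcc (0 : ℝ) 1, 0 < 1 + k * s ∧ 0 < 1 - k * s := by
    intro s hs
    rw [uIcc_of_le zero_le_one] at hs
    have := mul_nonneg hk0 hs.1
    exact ⟨by linarith, by nlinarith [hs.2]⟩
  have hprod : ∀ s, 1 - k ^ 2 * s ^ 2 = (1 + k * s) * (1 - k * s) := fun s => by ring
  rw [intervalIntegral.integral_eq_sub_of_hasDerivAt
    (f := fun s => Real.log (1 + k * s) - Real.log (1 - k * s))]
  · simp
  · intro s hs
    obtain ⟨h1, h2⟩ := hpos s hs
    have hd := (hasDerivAt_id s).const_mul k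
    have h := ((hd.const_add 1).log h1.ne').sub ((hd.const_sub 1).log h2.ne')
    refine h.congr_deriv ?_
    simp only [id, hprod]
    field_simp
    ring
  · refine ContinuousOn.intervalIntegrable (ContinuousOn.div (by fun_prop) (by fun_prop) ?_)
    intro s hs
    obtain ⟨h1, h2⟩ := hpos s hs
    rw [hprod]
    positivity

lemma mul_one_sub_sq_add_pos {x t s : ℝ} (hx : 0 < x) (ht : x ≤ t) (hs : s ∈ Icc (0 : ℝ) 1) :
    0 < t * (1 - s ^ 2) + x * s ^ 2 := by
  have : s ^ 2 ≤ 1 := pow_le_one₀ hs.1 hs.2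
  nlinarith

lemma Hw3_div_sqrt_eq_integral {x t : ℝ} (hx0 : 0 < x) (hxt : x < t) (ht1 : t < 1) :
    Hw3 (x / t) / √(t * (1 - t)) =
      ∫ s in (0 : ℝ)..1, (√(1 - t))⁻¹ * (2 * √(t - x) / (t * (1 - s ^ 2) + x * s ^ 2)) := by
  have ht0 : 0 < t := hx0.trans hxt
  have hk1 : √(1 - x / t) < 1 := by
    rw [Real.sqrt_lt' one_pos]; linarith [div_pos hx0 ht0]
  rw [Hw3_eq_log (div_pos hx0 ht0) ((div_lt_one ht0).2 hxt),
    ← integral_two_mul_div_one_sub_sq (Real.sqrt_nonneg _) hk1,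
    ← intervalIntegral.integral_div]
  refine intervalIntegral.integral_congr fun s hs => ?_
  rw [uIcc_of_le zero_le_one] at hs
  have hD := mul_one_sub_sq_add_pos hx0 hxt.le hs
  have hk2 : √(1 - x / t) ^ 2 = 1 - x / t :=
    Real.sq_sqrt (by linarith [(div_lt_one ht0).2 hxt])
  have hk : √(1 - x / t) = √(t - x) / √t := by
    rw [← Real.sqrt_div (by linarith)]; congr 1; field_simp
  have e : 1 - (1 - x / t) * s ^ 2 = (t * (1 - s ^ 2) + x * s ^ 2) / t := by
    field_simp; ring
  have ht2 : √t ^ 2 = t := Real.sq_sqrt ht0.le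
  have hst : 0 < √t := Real.sqrt_pos.2 ht0
  have hq : 0 < √(1 - t) := Real.sqrt_pos.2 (sub_pos.2 ht1)
  rw [hk2, e, hk, Real.sqrt_mul ht0.le]
  field_simp
  rw [ht2, mul_comm]

/-- Fubini's theorem for the iterated integral representing `Hw3` against a continuous weight. -/
lemma integral_mul_Hw3_div_sqrt {x : ℝ} (hx0 : 0 < x) (hx1 : x < 1) {w : ℝ → ℝ}
    (hw : ContinuousOn w (Icc x 1)) :
    ∫ t in x..1, w t * (Hw3 (x / t) / √(t * (1 - t))) =
      ∫ s in (0 : ℝ)..1, ∫ t in x..1,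
        (√(1 - t))⁻¹ * (w t * (2 * √(t - x) / (t * (1 - s ^ 2) + x * s ^ 2))) := by
  rw [← intervalIntegral_intervalIntegral_swap]
  · refine intervalIntegral.integral_congr_Ioo_of_le hx1.le fun t ht => ?_
    rw [Hw3_div_sqrt_eq_integral hx0 ht.1 ht.2, ← intervalIntegral.integral_const_mul]
    congr 1
    ext s
    ring
  · rw [uIoc_of_le hx1.le, uIoc_of_le zero_le_one]
    refine IntegrableOn.mul_continuousOn_of_subset (K := Icc x 1 ×ˢ Icc (0 : ℝ) 1)
      (g := fun p : ℝ × ℝ => (√(1 - p.1))⁻¹)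
      (g' := fun p : ℝ × ℝ =>
        w p.1 * (2 * √(p.1 - x) / (p.1 * (1 - p.2 ^ 2) + x * p.2 ^ 2))) ?_ ?_
      (measurableSet_Ioc.prod measurableSet_Ioc) (isCompact_Icc.prod isCompact_Icc)
      (prod_mono Ioc_subset_Icc_self Ioc_subset_Icc_self)
    · have h := (intervalIntegrable_iff_integrableOn_Ioc_of_le hx1.le).1
        (intervalIntegrable_inv_sqrt_one_sub hx1)
      rw [IntegrableOn, Measure.volume_eq_prod, ← Measure.prod_restrict]
      exact Integrable.comp_fst h _
    · refine ContinuousOn.mul (hw.comp continuousOn_fst fun p hp => hp.1)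
        (ContinuousOn.div (by fun_prop) (by fun_prop) fun p hp => ?_)
      exact (mul_one_sub_sq_add_pos hx0 hp.1.1 hp.2).ne'

lemma one_sub_mul_sq_pos {x s : ℝ} (hx0 : 0 < x) (hx1 : x < 1) (hs : s ∈ Icc (0 : ℝ) 1) :
    0 < 1 - (1 - x) * s ^ 2 := by
  have : s ^ 2 ≤ 1 := pow_le_one₀ hs.1 hs.2
  nlinarith

/-- The inner integral, as a multiple of `integral_sqrt_div_sub` at the pole
`z = -x s² / (1 - s²)`. -/
lemma integral_sqrt_div_mul_one_sub_sq_add {x s : ℝ} (hx0 : 0 < x) (hx1 : x < 1)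
    (hs : s ∈ Ioo (0 : ℝ) 1) :
    ∫ t in x..1, (√(1 - t))⁻¹ * (√(t - x) / (t - -(x * s ^ 2 / (1 - s ^ 2)))) =
      Real.pi * (1 - √x / √(1 - (1 - x) * s ^ 2)) := by
  have hs2 : 0 < 1 - s ^ 2 := by nlinarith [hs.1, hs.2]
  have hQ := one_sub_mul_sq_pos hx0 hx1 (Ioo_subset_Icc_self hs)
  have hz : 0 ≤ x * s ^ 2 / (1 - s ^ 2) := by positivity
  refine integral_sqrt_div_sub hx1 (by linarith)
    (div_pos (Real.sqrt_pos.2 hx0) (Real.sqrt_pos.2 hQ)) ?_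
  rw [div_pow, Real.sq_sqrt hx0.le, Real.sq_sqrt hQ.le]
  field_simp
  ring

lemma hasDerivAt_sqrt_one_sub_mul_sq {x s : ℝ} (h : 0 < 1 - (1 - x) * s ^ 2) :
    HasDerivAt (fun s => √(1 - (1 - x) * s ^ 2))
      (-((1 - x) * s) / √(1 - (1 - x) * s ^ 2)) s := by
  have hq : 0 < √(1 - (1 - x) * s ^ 2) := Real.sqrt_pos.2 h
  refine (((((hasDerivAt_id s).pow 2).const_mul (1 - x)).const_sub 1).sqrt h.ne').congr_deriv ?_
  simp only [id, Pi.pow_apply]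
  field_simp
  ring

lemma integral_Hw3_div_sqrt {x : ℝ} (hx0 : 0 < x) (hx1 : x < 1) :
    ∫ t in x..1, Hw3 (x / t) / √(t * (1 - t)) = -(Real.pi * Real.log x) := by
  have hF := integral_mul_Hw3_div_sqrt hx0 hx1 (w := fun _ => 1) continuousOn_const
  simp only [one_mul] at hF
  rw [hF]
  have hsx : 0 < √x := Real.sqrt_pos.2 hx0
  have hsx2 : √x ^ 2 = x := Real.sq_sqrt hx0.le
  have hQ : ∀ s ∈ uIcc (0 : ℝ) 1, 0 < 1 - (1 - x) * s ^ 2 := fun s hs =>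
    one_sub_mul_sq_pos hx0 hx1 (by rwa [uIcc_of_le zero_le_one] at hs)
  have hden : ∀ s ∈ uIcc (0 : ℝ) 1, 0 < √(1 - (1 - x) * s ^ 2) + √x * s := fun s hs => by
    have := Real.sqrt_pos.2 (hQ s hs)
    rw [uIcc_of_le zero_le_one] at hs
    have := mul_nonneg hsx.le hs.1
    positivity
  have hcongr : ∫ s in (0 : ℝ)..1, ∫ t in x..1,
        (√(1 - t))⁻¹ * (2 * √(t - x) / (t * (1 - s ^ 2) + x * s ^ 2)) =
      ∫ s in (0 : ℝ)..1, 2 * Real.pi * (1 / (1 + s) -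
        (-((1 - x) * s) / √(1 - (1 - x) * s ^ 2) + √x * 1) /
          (√(1 - (1 - x) * s ^ 2) + √x * s)) := by
    refine intervalIntegral.integral_congr_Ioo_of_le zero_le_one fun s hs => ?_
    have hs2 : 0 < 1 - s ^ 2 := by nlinarith [hs.1, hs.2]
    have hs' : s ∈ uIcc (0 : ℝ) 1 := by
      rw [uIcc_of_le zero_le_one]; exact Ioo_subset_Icc_self hs
    have hq := Real.sqrt_pos.2 (hQ s hs')
    have hq2 := Real.sq_sqrt (hQ s hs').le
    have hd := hden s hs'
    have h1s : 0 < 1 + s := by linarith [hs.1]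
    have hsplit : ∫ t in x..1, (√(1 - t))⁻¹ * (2 * √(t - x) / (t * (1 - s ^ 2) + x * s ^ 2)) =
        2 / (1 - s ^ 2) * (Real.pi * (1 - √x / √(1 - (1 - x) * s ^ 2))) := by
      rw [← integral_sqrt_div_mul_one_sub_sq_add hx0 hx1 hs,
        ← intervalIntegral.integral_const_mul]
      refine intervalIntegral.integral_congr fun t _ => ?_
      have e : t * (1 - s ^ 2) + x * s ^ 2 =
          (1 - s ^ 2) * (t - -(x * s ^ 2 / (1 - s ^ 2))) := by field_simp; ring
      simp only [e]
      rw [mul_div_mul_comm]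
      ring
    rw [hsplit]
    have hx : x = √x ^ 2 := hsx2.symm
    generalize √(1 - (1 - x) * s ^ 2) = q at *
    generalize √x = w at *
    subst hx
    have hs2' : 1 - s ^ 2 = (q + w * s) * (q - w * s) := by linear_combination -hq2
    have e : 1 / (1 + s) - (-((1 - w ^ 2) * s) / q + w * 1) / (q + w * s) =
        (1 - w / q) / (1 - s ^ 2) := by
      rw [eq_div_iff hs2.ne', sub_mul, show 1 / (1 + s) * (1 - s ^ 2) = 1 - s by field_simp; ring,
        hs2', show ∀ a, a / (q + w * s) * ((q + w * s) * (q - w * s)) = a * (q - w * s) from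
          fun a => by field_simp]
      field_simp
      linear_combination (-w) * hq2
    rw [e]
    ring
  rw [hcongr, intervalIntegral.integral_const_mul,
    intervalIntegral.integral_eq_sub_of_hasDerivAt
      (f := fun s => Real.log (1 + s) - Real.log (√(1 - (1 - x) * s ^ 2) + √x * s))]
  · have : Real.log (√x + √x) = Real.log 2 + Real.log x / 2 := by
      rw [← two_mul, Real.log_mul two_ne_zero hsx.ne', Real.log_sqrt hx0.le]
    norm_num [this]
    ring
  · intro s hs
    have h1s : 1 + s ≠ 0 := by
      rw [uIcc_of_le zero_le_one] at hs; linarith [hs.1]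
    exact (((hasDerivAt_id s).const_add 1).log h1s).sub
      (((hasDerivAt_sqrt_one_sub_mul_sq (hQ s hs)).add
        ((hasDerivAt_id s).const_mul (√x))).log (hden s hs).ne')
  · refine ContinuousOn.intervalIntegrable (ContinuousOn.sub ?_ ?_)
    · refine ContinuousOn.div (by fun_prop) (by fun_prop) fun s hs => ?_
      rw [uIcc_of_le zero_le_one] at hs
      linarith [hs.1]
    · refine ContinuousOn.div (ContinuousOn.add (ContinuousOn.div (by fun_prop) (by fun_prop)
        fun s hs => (Real.sqrt_pos.2 (hQ s hs)).ne') (by fun_prop)) (by fun_prop)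
        fun s hs => (hden s hs).ne'

lemma integral_inv_sqrt_mul_sub {c x : ℝ} (hc : 1 < c) (hx0 : 0 < x) (hx1 : x < 1) :
    ∫ t in x..1, (√(t * (c - t)))⁻¹ =
      2 * Real.arctan (√(c - x) / √x) - 2 * Real.arctan (√(c - 1)) := by
  have hpos : ∀ t ∈ uIcc x 1, 0 < t ∧ 0 < c - t := fun t ht => by
    rw [uIcc_of_le hx1.le] at ht
    exact ⟨by linarith [ht.1], by linarith [ht.2]⟩
  rw [intervalIntegral.integral_eq_sub_of_hasDerivAt
    (f := fun t => -2 * Real.arctan (√(c - t) / √t))]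
  · simp
    ring
  · intro t ht
    obtain ⟨h1, h2⟩ := hpos t ht
    have ha := Real.sqrt_pos.2 h1
    have hb := Real.sqrt_pos.2 h2
    have h := (((((hasDerivAt_id t).const_sub c).sqrt h2.ne').div
      ((hasDerivAt_id t).sqrt h1.ne') ha.ne').arctan).const_mul (-2)
    refine h.congr_deriv ?_
    simp only [id, Pi.div_apply]
    rw [Real.sqrt_mul h1.le]
    generalize √(c - t) = b at *
    generalize √t = a at *
    field_simp
    ring
  · refine ContinuousOn.intervalIntegrable (ContinuousOn.inv₀ (by fun_prop) fun t ht => ?_)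
    obtain ⟨h1, h2⟩ := hpos t ht
    positivity

lemma integral_Hw3_div_sub_mul_sqrt {c x : ℝ} (hc : 1 < c) (hx0 : 0 < x) (hx1 : x < 1) :
    ∫ t in x..1, (x - c * t)⁻¹ * (Hw3 (x / t) / √(t * (1 - t))) =
      -(Real.pi / √(x * (c - x))) * ∫ t in x..1, (√(t * (c - t)))⁻¹ := by
  have hneg : ∀ t, x ≤ t → x - c * t < 0 := fun t ht => by nlinarith
  have hw : ContinuousOn (fun t => (x - c * t)⁻¹) (Icc x 1) :=
    ContinuousOn.inv₀ (by fun_prop) fun t ht => (hneg t ht.1).ne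
  rw [integral_mul_Hw3_div_sqrt hx0 hx1 hw, integral_inv_sqrt_mul_sub hc hx0 hx1]
  have hcx : 0 < c - x := by linarith
  have hc1 : 0 < c - 1 := by linarith
  have hsx : 0 < √x := Real.sqrt_pos.2 hx0
  have hsx2 : √x ^ 2 = x := Real.sq_sqrt hx0.le
  have hm : 0 < √(c - x) := Real.sqrt_pos.2 hcx
  have hm2 : √(c - x) ^ 2 = c - x := Real.sq_sqrt hcx.le
  have hn : 0 < √(c - 1) := Real.sqrt_pos.2 hc1
  have hn2 : √(c - 1) ^ 2 = c - 1 := Real.sq_sqrt hc1.le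
  have hQ : ∀ s ∈ uIcc (0 : ℝ) 1, 0 < 1 - (1 - x) * s ^ 2 := fun s hs =>
    one_sub_mul_sq_pos hx0 hx1 (by rwa [uIcc_of_le zero_le_one] at hs)
  have hpole : ∫ t in x..1, (√(1 - t))⁻¹ * (√(t - x) / (t - x / c)) =
      Real.pi * (1 - √x * √(c - 1) / √(c - x)) := by
    refine integral_sqrt_div_sub hx1 ((div_lt_iff₀ (by linarith)).2 (by nlinarith))
      (by positivity) ?_
    rw [div_pow, mul_pow, hsx2, hm2, hn2]
    field_simp
  have hcongr : ∫ s in (0 : ℝ)..1, ∫ t in x..1,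
        (√(1 - t))⁻¹ * ((x - c * t)⁻¹ * (2 * √(t - x) / (t * (1 - s ^ 2) + x * s ^ 2))) =
      ∫ s in (0 : ℝ)..1, 2 * Real.pi / √x * ((√(c - 1) / √(c - x) -
        1 / √(1 - (1 - x) * s ^ 2)) / (1 + (c - 1) * s ^ 2)) := by
    refine intervalIntegral.integral_congr_Ioo_of_le zero_le_one fun s hs => ?_
    have hs2 : 0 < 1 - s ^ 2 := by nlinarith [hs.1, hs.2]
    have hs' : s ∈ uIcc (0 : ℝ) 1 := by
      rw [uIcc_of_le zero_le_one]; exact Ioo_subset_Icc_self hs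
    have hq := Real.sqrt_pos.2 (hQ s hs')
    have hE : 0 < 1 + (c - 1) * s ^ 2 := by positivity
    have hsplit : ∫ t in x..1, (√(1 - t))⁻¹ *
          ((x - c * t)⁻¹ * (2 * √(t - x) / (t * (1 - s ^ 2) + x * s ^ 2))) =
        2 / (x * (1 + (c - 1) * s ^ 2)) *
          (Real.pi * (1 - √x / √(1 - (1 - x) * s ^ 2)) -
            Real.pi * (1 - √x * √(c - 1) / √(c - x))) := by
      rw [← integral_sqrt_div_mul_one_sub_sq_add hx0 hx1 hs, ← hpole,
        ← intervalIntegral.integral_sub, ← intervalIntegral.integral_const_mul]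
      · refine intervalIntegral.integral_congr fun t ht => ?_
        rw [uIcc_of_le hx1.le] at ht
        have hD := mul_one_sub_sq_add_pos hx0 ht.1 (Ioo_subset_Icc_self hs)
        have e1 : t - -(x * s ^ 2 / (1 - s ^ 2)) =
          (t * (1 - s ^ 2) + x * s ^ 2) / (1 - s ^ 2) := by field_simp; ring
        have e2 : t - x / c = -(x - c * t) / c := by field_simp; ring
        have h3 := (hneg t ht.1).ne
        rw [← mul_sub, e1, e2]
        have e3 : (x - c * t)⁻¹ * (2 * √(t - x) / (t * (1 - s ^ 2) + x * s ^ 2)) =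
            2 / (x * (1 + (c - 1) * s ^ 2)) *
              (√(t - x) / ((t * (1 - s ^ 2) + x * s ^ 2) / (1 - s ^ 2)) -
                √(t - x) / (-(x - c * t) / c)) := by
          generalize √(t - x) = p
          field_simp
          ring
        rw [e3]
        ring
      · refine intervalIntegrable_inv_sqrt_one_sub_mul hx1
          (ContinuousOn.div (by fun_prop) (by fun_prop) fun t ht => ?_)
        have : 0 ≤ x * s ^ 2 / (1 - s ^ 2) := by positivity
        linarith [ht.1]
      · refine intervalIntegrable_inv_sqrt_one_sub_mul hx1
          (ContinuousOn.div (by fun_prop) (by fun_prop) fun t ht => ?_)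
        have : x / c < x := (div_lt_iff₀ (by linarith)).2 (by nlinarith)
        linarith [ht.1]
    rw [hsplit]
    have hx : x = √x ^ 2 := hsx2.symm
    nth_rewrite 1 [hx]
    field_simp
    ring
  rw [hcongr, intervalIntegral.integral_const_mul,
    intervalIntegral.integral_eq_sub_of_hasDerivAt
      (f := fun s => 1 / √(c - x) * (Real.arctan (√(c - 1) * s) -
        Real.arctan (√(c - x) * s / √(1 - (1 - x) * s ^ 2))))]
  · rw [Real.sqrt_mul hx0.le]
    norm_num
    field_simp
    ring
  · intro s hs
    have hq := Real.sqrt_pos.2 (hQ s hs)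
    have hq2 := Real.sq_sqrt (hQ s hs).le
    have hE : 0 < 1 + (c - 1) * s ^ 2 := by positivity
    have h := (((hasDerivAt_id s).const_mul √(c - 1)).arctan.sub
      (((hasDerivAt_id s).const_mul √(c - x)).div
        (hasDerivAt_sqrt_one_sub_mul_sq (hQ s hs)) hq.ne').arctan).const_mul (1 / √(c - x))
    refine h.congr_deriv ?_
    simp only [id, Pi.div_apply]
    generalize √(1 - (1 - x) * s ^ 2) = q at *
    have e1 : 1 + (√(c - 1) * s) ^ 2 = 1 + (c - 1) * s ^ 2 := by rw [mul_pow, hn2]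
    have e2 : 1 + (√(c - x) * s / q) ^ 2 = (1 + (c - 1) * s ^ 2) / q ^ 2 := by
      rw [div_pow, mul_pow, hm2]
      field_simp
      rw [hq2]; ring
    have e3 : (√(c - x) * 1 * q - √(c - x) * s * (-((1 - x) * s) / q)) / q ^ 2 =
        √(c - x) / q ^ 3 := by
      field_simp
      rw [hq2]; ring
    rw [e1, e2, e3]
    field_simp
  · refine ContinuousOn.intervalIntegrable (ContinuousOn.div (ContinuousOn.sub (by fun_prop)
      (ContinuousOn.div (by fun_prop) (by fun_prop)
        fun s hs => (Real.sqrt_pos.2 (hQ s hs)).ne')) (by fun_prop) fun s _ => ?_)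
    positivity

/-- Equations (4.11)–(4.12): for `c > 1` and `0 < x < 1`,
(i) `∫_x^1 H_{w₃}(x/t)/((x-ct)·√(t(1-t))) dt = -(π/√(x(c-x)))·∫_x^1 dt/√(t(c-t))`, and
(ii) `∫_x^1 t·H_{w₃}(x/t)/((x-ct)·√(t(1-t))) dt
      = -(π/c)·(-ln x + √(x/(c-x))·∫_x^1 dt/√(t(c-t)))`. -/
theorem stmt_6 (c x : ℝ) (hc : 1 < c) (hx0 : 0 < x) (hx1 : x < 1) :
    ((∫ t in x..1, Hw3 (x / t) / ((x - c * t) * Real.sqrt (t * (1 - t)))) =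
      -(Real.pi / Real.sqrt (x * (c - x))) *
        ∫ t in x..1, (Real.sqrt (t * (c - t)))⁻¹) ∧
    ((∫ t in x..1, t * Hw3 (x / t) / ((x - c * t) * Real.sqrt (t * (1 - t)))) =
      -(Real.pi / c) *
        (-Real.log x + Real.sqrt (x / (c - x)) *
          ∫ t in x..1, (Real.sqrt (t * (c - t)))⁻¹)) := by
  have hneg : ∀ t ∈ uIcc x 1, x - c * t < 0 := fun t ht => by
    rw [uIcc_of_le hx1.le] at ht; nlinarith [ht.1]
  have hi := integral_Hw3_div_sub_mul_sqrt hc hx0 hx1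
  have hcont : ContinuousOn (fun t => (x - c * t)⁻¹) (uIcc x 1) :=
    ContinuousOn.inv₀ (by fun_prop) fun t ht => (hneg t ht).ne
  refine ⟨?_, ?_⟩
  · rw [← hi]
    congr 1
    ext t
    rw [div_mul_eq_div_div_swap, div_eq_inv_mul _ (x - c * t)]
  · by_cases hH : IntervalIntegrable (fun t => Hw3 (x / t) / √(t * (1 - t))) volume x 1
    · have hsplit : ∫ t in x..1, t * Hw3 (x / t) / ((x - c * t) * √(t * (1 - t))) =
          ∫ t in x..1, (x / c * ((x - c * t)⁻¹ * (Hw3 (x / t) / √(t * (1 - t)))) -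
            1 / c * (Hw3 (x / t) / √(t * (1 - t)))) := by
        refine intervalIntegral.integral_congr fun t ht => ?_
        have h := (hneg t ht).ne
        have e : t * (x - c * t)⁻¹ = x / c * (x - c * t)⁻¹ - 1 / c := by
          have hc0 : c ≠ 0 := by linarith
          obtain ⟨u, hu⟩ : ∃ u, u = x - c * t := ⟨_, rfl⟩
          rw [← hu] at h ⊢
          field_simp
          linear_combination hu
        rw [← mul_assoc (x / c), ← sub_mul, ← e]
        generalize x - c * t = u
        rw [div_mul_eq_div_div]
        ring
      rw [hsplit, intervalIntegral.integral_sub ((hH.continuousOn_mul hcont).const_mul _)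
        (hH.const_mul _), intervalIntegral.integral_const_mul,
        intervalIntegral.integral_const_mul, hi, integral_Hw3_div_sqrt hx0 hx1,
        Real.sqrt_mul hx0.le, Real.sqrt_div hx0.le]
      have hcx : 0 < √(c - x) := Real.sqrt_pos.2 (by linarith)
      have hsx : 0 < √x := Real.sqrt_pos.2 hx0
      have hsx2 : √x ^ 2 = x := Real.sq_sqrt hx0.le
      field_simp
      linear_combination (∫ t in x..1, 1 / √(t * (c - t))) * hsx2
    · have h0 := intervalIntegral.integral_undef hH
      rw [integral_Hw3_div_sqrt hx0 hx1, neg_eq_zero] at h0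
      have := Real.log_neg hx0 hx1
      exact absurd h0 (mul_ne_zero Real.pi_ne_zero this.ne)
end

section
/- Let k ≥ 0 and a_0, …, a_k < 0. Define letters f_{a_i}(t) = 1/(t−a_i) for i = 1,…,k, f_{b_i}(t) = 1/√((t−a_i)(t−a_{i+1})) for i = 0,…,k−1, and f_{b_k}(t) = 1/√((1−t)(t−a_k)). Then (i) for every x ∈ (0,1): ∫_x^1 H_{f_{a_1},…,f_{a_k}}(t)/((t−a_0)·√(t−x)) dt = H_{f_{b_0},…,f_{b_k}}(x)/√(x−a_0); and (ii) for every natural number N: C(2N,N)·∫_0^1 x^N·H_{f_{a_1},…,f_{a_k}}(x)/(x−a_0) dx = (4^N/π)·∫_0^1 x^N·H_{f_{b_0},…,f_{b_k}}(x)/√(x·(x−a_0)) dx. (For k = 0 the word a_1,…,a_k is empty and H of the empty word equals 1.) -/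
/-- Iterated integral over a word of letters (integrable functions on `(0,1]`):
`H_∅(x) = 1`, `H_{g,w}(x) = ∫_x^1 g(t)·H_w(t) dt`. -/
noncomputable def Hiter : List (ℝ → ℝ) → ℝ → ℝ
  | [], _ => 1
  | g :: gs, x => ∫ t in x..1, g t * Hiter gs t

/-- The rational letter `f_b(t) = 1/(t-b)`. -/
noncomputable def fA (b : ℝ) : ℝ → ℝ := fun t => (t - b)⁻¹

/-- The root-valued letters `f_{b_i}(t) = 1/√((t-a_i)(t-a_{i+1}))` for `i < k`
and `f_{b_k}(t) = 1/√((1-t)(t-a_k))`. -/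
noncomputable def fB (k : ℕ) (a : ℕ → ℝ) (i : ℕ) : ℝ → ℝ := fun t =>
  if i < k then (Real.sqrt ((t - a i) * (t - a (i + 1))))⁻¹
  else (Real.sqrt ((1 - t) * (t - a k)))⁻¹

open MeasureTheory Set intervalIntegral in
/-- Exchanging the order of integration against the Abel kernel `(t - s)^(-1/2)` on a triangle. -/
theorem integral_abel_kernel_swap {p q : ℝ → ℝ} {x y : ℝ} (hxy : x ≤ y)
    (hp : IntervalIntegrable p volume x y) (hq : ContinuousOn q (Icc x y)) :
    ∫ s in x..y, p s * ∫ t in s..y, q t * (√(t - s))⁻¹ =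
      ∫ t in x..y, q t * ∫ s in x..t, p s * (√(t - s))⁻¹ := by
  have hk : Integrable (indicator (Ioc 0 (y - x)) fun u : ℝ => (√u)⁻¹) := by
    rw [integrable_indicator_iff measurableSet_Ioc,
      ← intervalIntegrable_iff_integrableOn_Ioc_of_le (by linarith)]
    refine (intervalIntegrable_rpow' (r := -1 / 2) (by norm_num)).congr fun u hu => ?_
    rw [uIoc_of_le (by linarith)] at hu
    simp only [Real.sqrt_eq_rpow, ← Real.rpow_neg hu.1.le]
    norm_num
  have hp' : Integrable (indicator (Ioc x y) p) := by
    rw [integrable_indicator_iff measurableSet_Ioc]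
    exact (intervalIntegrable_iff_integrableOn_Ioc_of_le hxy).1 hp
  have hconv := hp'.convolution_integrand (ContinuousLinearMap.mul ℝ ℝ) hk
  obtain ⟨C, hC⟩ := isCompact_Icc.exists_bound_of_continuousOn hq
  have hqm : AEStronglyMeasurable (indicator (Ioc x y) q) volume := by
    rw [aestronglyMeasurable_indicator_iff measurableSet_Ioc]
    exact (hq.mono Ioc_subset_Icc_self).aestronglyMeasurable measurableSet_Ioc
  have hint := hconv.bdd_mul (c := C) hqm.comp_fst (ae_of_all _ fun z => by
    by_cases hz : z.1 ∈ Ioc x y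
    · rw [indicator_of_mem hz]
      exact hC _ (Ioc_subset_Icc_self hz)
    · rw [indicator_of_notMem hz, norm_zero]
      exact (norm_nonneg _).trans (hC x (left_mem_Icc.2 hxy)))
  have hswap := integral_integral_swap (f := fun t s => indicator (Ioc x y) q t *
    (ContinuousLinearMap.mul ℝ ℝ (indicator (Ioc x y) p s))
      (indicator (Ioc 0 (y - x)) (fun u : ℝ => (√u)⁻¹) (t - s))) hint
  simp only [ContinuousLinearMap.mul_apply'] at hswap
  rw [intervalIntegral.integral_of_le hxy, intervalIntegral.integral_of_le hxy,
    ← MeasureTheory.integral_indicator measurableSet_Ioc, ← MeasureTheory.integral_indicator measurableSet_Ioc]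
  convert hswap.symm using 1
  · congr 1 with s
    by_cases hs : s ∈ Ioc x y
    · rw [indicator_of_mem hs, indicator_of_mem hs, intervalIntegral.integral_of_le hs.2,
        ← MeasureTheory.integral_const_mul, ← MeasureTheory.integral_indicator measurableSet_Ioc]
      congr 1 with t
      by_cases ht : t ∈ Ioc s y
      · rw [indicator_of_mem ht, indicator_of_mem (s := Ioc x y) ⟨hs.1.trans ht.1, ht.2⟩,
          indicator_of_mem (s := Ioc 0 (y - x)) ⟨by linarith [ht.1], by linarith [ht.2, hs.1]⟩]
        ring
      · rw [indicator_of_notMem ht]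
        by_cases hty : t ∈ Ioc x y
        · rw [indicator_of_notMem (s := Ioc 0 (y - x))
            fun h => ht ⟨by linarith [h.1], hty.2⟩]
          simp
        · rw [indicator_of_notMem hty]
          simp
    · simp [indicator_of_notMem hs]
  · congr 1 with t
    by_cases ht : t ∈ Ioc x y
    · rw [indicator_of_mem ht, indicator_of_mem ht, intervalIntegral.integral_of_le ht.1.le,
        MeasureTheory.integral_const_mul, ← MeasureTheory.integral_indicator measurableSet_Ioc]
      congr 2 with s
      by_cases hs : s ∈ Ioc x t
      · rw [indicator_of_mem hs, indicator_of_mem (s := Ioc x y) ⟨hs.1, hs.2.trans ht.2⟩]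
        rcases hs.2.eq_or_lt with rfl | hst
        · simp
        · rw [indicator_of_mem (s := Ioc 0 (y - x))
            ⟨by linarith, by linarith [hs.1, ht.2]⟩]
      · rw [indicator_of_notMem hs]
        by_cases hsy : s ∈ Ioc x y
        · rw [indicator_of_notMem (s := Ioc 0 (y - x))
            fun h => hs ⟨hsy.1, by linarith [h.1]⟩]
          simp
        · rw [indicator_of_notMem hsy]
          simp
    · simp [indicator_of_notMem ht]

/-- The arctangent primitive of the Abel kernel, as a function of the upper limit. -/
theorem hasDerivAt_two_mul_arctan_upper {a x t : ℝ} (hax : a < x) (hxt : x < t) :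
    HasDerivAt (fun t => 2 * Real.arctan (√(t - x) / √(x - a)))
      (√(x - a) * ((t - a)⁻¹ * (√(t - x))⁻¹)) t := by
  have hP : 0 < √(t - x) := Real.sqrt_pos.2 (by linarith)
  have hQ : 0 < √(x - a) := Real.sqrt_pos.2 (by linarith)
  have hP2 : √(t - x) ^ 2 = t - x := Real.sq_sqrt (by linarith)
  have hQ2 : √(x - a) ^ 2 = x - a := Real.sq_sqrt (by linarith)
  have h := (((((hasDerivAt_id t).sub_const x).sqrt
    (by simp only [id]; linarith)).div_const (√(x - a))).arctan).const_mul 2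
  refine h.congr_deriv ?_
  simp only [id]
  have e : t - a = √(t - x) ^ 2 + √(x - a) ^ 2 := by rw [hP2, hQ2]; ring
  rw [e]
  field_simp
  ring

/-- The arctangent primitive of the Abel kernel, as a function of the lower limit. -/
theorem hasDerivAt_neg_two_mul_arctan_lower {a s t : ℝ} (has : a < s) (hst : s < t) :
    HasDerivAt (fun s => -(2 * Real.arctan (√(t - s) / √(s - a))))
      ((√(s - a))⁻¹ * (√(t - s))⁻¹) s := by
  have hP : 0 < √(t - s) := Real.sqrt_pos.2 (by linarith)
  have hQ : 0 < √(s - a) := Real.sqrt_pos.2 (by linarith)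
  have h := ((((((hasDerivAt_id s).const_sub t).sqrt
    (by simp only [id]; linarith)).div (((hasDerivAt_id s).sub_const a).sqrt
    (by simp only [id]; linarith)) hQ.ne').arctan).const_mul 2).neg
  refine h.congr_deriv ?_
  simp only [id, Pi.div_apply]
  field_simp
  ring

open MeasureTheory Set in
theorem continuousOn_two_mul_arctan_upper {a x : ℝ} (s : Set ℝ) :
    ContinuousOn (fun t => 2 * Real.arctan (√(t - x) / √(x - a))) s := by
  fun_prop

open MeasureTheory Set in
theorem intervalIntegrable_inv_mul_inv_sqrt {a x y : ℝ} (hax : a < x) (hxy : x ≤ y) :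
    IntervalIntegrable (fun t => √(x - a) * ((t - a)⁻¹ * (√(t - x))⁻¹)) volume x y := by
  refine intervalIntegral.intervalIntegrable_deriv_of_nonneg
    (continuousOn_two_mul_arctan_upper (a := a) (x := x) _) (fun t ht => ?_) (fun t ht => ?_)
  · rw [min_eq_left hxy] at ht
    exact hasDerivAt_two_mul_arctan_upper hax ht.1
  · rw [min_eq_left hxy] at ht
    have : 0 < t - a := by linarith [ht.1]
    positivity

open MeasureTheory Set in
theorem integral_inv_sqrt_mul_inv_sqrt {a x t : ℝ} (hax : a < x) (hxt : x ≤ t) :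
    ∫ s in x..t, (√(s - a))⁻¹ * (√(t - s))⁻¹ = 2 * Real.arctan (√(t - x) / √(x - a)) := by
  have hc : ContinuousOn (fun s => -(2 * Real.arctan (√(t - s) / √(s - a)))) (Icc x t) := by
    refine (continuousOn_const.mul (Real.continuous_arctan.comp_continuousOn
      (ContinuousOn.div (by fun_prop) (by fun_prop) fun s hs => ?_))).neg
    exact (Real.sqrt_pos.2 (by linarith [hs.1])).ne'
  have hd : ∀ s ∈ Ioo x t, HasDerivAt (fun s => -(2 * Real.arctan (√(t - s) / √(s - a))))
      ((√(s - a))⁻¹ * (√(t - s))⁻¹) s := fun s hs =>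
    hasDerivAt_neg_two_mul_arctan_lower (hax.trans hs.1) hs.2
  rw [intervalIntegral.integral_eq_sub_of_hasDerivAt_of_le hxt hc hd]
  · simp
  · refine intervalIntegral.intervalIntegrable_deriv_of_nonneg (by rwa [uIcc_of_le hxt])
      (by rwa [min_eq_left hxt, max_eq_right hxt]) fun s _ => by positivity

open MeasureTheory Set in
theorem hasDerivAt_arcsin_affine {x t : ℝ} (hx : 0 < x) (hxt : x < t) :
    HasDerivAt (fun x => Real.arcsin (2 * x / t - 1)) ((√x)⁻¹ * (√(t - x))⁻¹) x := by
  have ht : 0 < t := hx.trans hxt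
  have h := (Real.hasDerivAt_arcsin (x := 2 * x / t - 1)
    (by have : 0 < 2 * x / t := by positivity
        linarith) (by
        have : 2 * x / t < 2 := by rw [div_lt_iff₀ ht]; linarith
        linarith)).comp x ((((hasDerivAt_id x).const_mul 2).div_const t).sub_const 1)
  refine h.congr_deriv ?_
  have e : 1 - (2 * x / t - 1) ^ 2 = (2 / t) ^ 2 * (x * (t - x)) := by field_simp; ring
  rw [e, Real.sqrt_mul (by positivity), Real.sqrt_sq (by positivity), Real.sqrt_mul hx.le]
  have : 0 < √x := Real.sqrt_pos.2 hx
  have : 0 < √(t - x) := Real.sqrt_pos.2 (by linarith)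
  field_simp

open MeasureTheory Set in
theorem intervalIntegrable_inv_sqrt_mul_inv_sqrt_sub {t : ℝ} (ht : 0 < t) :
    IntervalIntegrable (fun x => (√x)⁻¹ * (√(t - x))⁻¹) volume 0 t := by
  refine intervalIntegral.intervalIntegrable_deriv_of_nonneg
    (g := fun x => Real.arcsin (2 * x / t - 1))
    (Real.continuous_arcsin.comp (by fun_prop)).continuousOn ?_ fun s _ => by positivity
  rw [min_eq_left ht.le, max_eq_right ht.le]
  exact fun x hx => hasDerivAt_arcsin_affine hx.1 hx.2

open MeasureTheory Set in
theorem intervalIntegrable_pow_mul_inv_sqrt_mul_inv_sqrt_sub {t : ℝ} (ht : 0 < t) (N : ℕ) :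
    IntervalIntegrable (fun x => x ^ N * (√x)⁻¹ * (√(t - x))⁻¹) volume 0 t := by
  simp only [mul_assoc]
  exact (intervalIntegrable_inv_sqrt_mul_inv_sqrt_sub ht).continuousOn_mul (by fun_prop)

open MeasureTheory Set in
/-- The Beta integral `B(N + 1/2, 1/2)`, rescaled to `[0, t]`. -/
theorem integral_pow_mul_inv_sqrt_mul_inv_sqrt_sub {t : ℝ} (ht : 0 < t) (N : ℕ) :
    ∫ x in (0 : ℝ)..t, x ^ N * (√x)⁻¹ * (√(t - x))⁻¹ =
      t ^ N * (Real.pi * N.centralBinom / 4 ^ N) := by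
  induction N with
  | zero =>
    simp only [pow_zero, one_mul, Nat.centralBinom_zero, Nat.cast_one, mul_one, div_one]
    rw [intervalIntegral.integral_eq_sub_of_hasDerivAt_of_le ht.le
      (Real.continuous_arcsin.comp (by fun_prop)).continuousOn
      (fun x hx => hasDerivAt_arcsin_affine hx.1 hx.2)
      (intervalIntegrable_inv_sqrt_mul_inv_sqrt_sub ht)]
    have e : 2 * t / t - 1 = 1 := by field_simp; norm_num
    simp only [Function.comp_apply, e]
    simp
  | succ N ih =>
    have hN := intervalIntegrable_pow_mul_inv_sqrt_mul_inv_sqrt_sub ht N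
    have hN' := intervalIntegrable_pow_mul_inv_sqrt_mul_inv_sqrt_sub ht (N + 1)
    have hd : ∀ x ∈ Ioo 0 t, HasDerivAt (fun x => x ^ N * √x * √(t - x))
        ((N + 1 / 2) * t * (x ^ N * (√x)⁻¹ * (√(t - x))⁻¹) -
          (N + 1) * (x ^ (N + 1) * (√x)⁻¹ * (√(t - x))⁻¹)) x := by
      intro x hx
      have hP : 0 < √x := Real.sqrt_pos.2 hx.1
      have hQ : 0 < √(t - x) := Real.sqrt_pos.2 (by linarith [hx.2])
      have hP2 : √x ^ 2 = x := Real.sq_sqrt hx.1.le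
      have hQ2 : √(t - x) ^ 2 = t - x := Real.sq_sqrt (by linarith [hx.2])
      have h := ((hasDerivAt_pow N x).mul ((hasDerivAt_id x).sqrt hx.1.ne')).mul
        (((hasDerivAt_id x).const_sub t).sqrt (by simp only [id]; linarith [hx.2]))
      refine h.congr_deriv ?_
      simp only [id, Pi.mul_apply]
      have hpow : (N : ℝ) * x ^ (N - 1) = N * x ^ N / x := by
        have := hx.1.ne'
        cases N <;> simp [pow_succ]; field_simp
      rw [hpow]
      have hx0 := hx.1.ne'
      field_simp
      rw [hP2, hQ2]
      ring
    have h0 := intervalIntegral.integral_eq_sub_of_hasDerivAt_of_le ht.le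
      (by fun_prop) hd ((hN.const_mul _).sub (hN'.const_mul _))
    rw [intervalIntegral.integral_sub (hN.const_mul _) (hN'.const_mul _),
      intervalIntegral.integral_const_mul, intervalIntegral.integral_const_mul, ih] at h0
    have hb : ((N : ℝ) + 1) * (N + 1).centralBinom = 2 * (2 * N + 1) * N.centralBinom := by
      exact_mod_cast Nat.succ_mul_centralBinom_succ N
    simp only [sub_self, Real.sqrt_zero, mul_zero, zero_mul] at h0
    have h1 : (0 : ℝ) < N + 1 := by positivity
    rw [← mul_right_inj' h1.ne', ← sub_eq_zero.1 h0]
    have e : ((N : ℝ) + 1) * (t ^ (N + 1) * (Real.pi * (N + 1).centralBinom / 4 ^ (N + 1))) =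
      t ^ (N + 1) * (Real.pi * (((N : ℝ) + 1) * (N + 1).centralBinom) / 4 ^ (N + 1)) := by ring
    rw [e, hb, pow_succ 4]
    field_simp
    ring

open MeasureTheory Set in
theorem continuousOn_Hiter (l : List (ℝ → ℝ)) (hl : ∀ g ∈ l, ContinuousOn g (Icc 0 1)) :
    ContinuousOn (Hiter l) (Icc 0 1) := by
  induction l with
  | nil => exact continuousOn_const
  | cons g l ih =>
    have h : ContinuousOn (fun t => g t * Hiter l t) (Icc 0 1) :=
      (hl g (by simp)).mul (ih fun f hf => hl f (by simp [hf]))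
    have := intervalIntegral.continuousOn_primitive_interval_left (a := (0 : ℝ)) (b := 1)
      (f := fun t => g t * Hiter l t) (μ := volume)
      (by rw [uIcc_of_le zero_le_one]; exact h.integrableOn_Icc)
    rwa [uIcc_of_le zero_le_one] at this

open Set in
theorem continuousOn_fA {b : ℝ} (hb : b < 0) : ContinuousOn (fA b) (Icc 0 1) :=
  (continuousOn_id.sub continuousOn_const).inv₀ fun _ ht =>
    (sub_pos.2 (hb.trans_le ht.1)).ne'

open Set in
theorem continuousOn_Hiter_fA {k : ℕ} {a : ℕ → ℝ} (ha : ∀ i ≤ k, a i < 0) :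
    ContinuousOn (Hiter ((List.range k).map fun i => fA (a (i + 1)))) (Icc 0 1) := by
  refine continuousOn_Hiter _ fun g hg => ?_
  obtain ⟨i, hi, rfl⟩ := List.mem_map.1 hg
  exact continuousOn_fA (ha _ (List.mem_range.1 hi))

theorem Hiter_fA_succ (k : ℕ) (a : ℕ → ℝ) :
    Hiter ((List.range (k + 1)).map fun i => fA (a (i + 1))) = fun x =>
      ∫ t in x..1, fA (a 1) t * Hiter ((List.range k).map fun i => fA (a (i + 1 + 1))) t := by
  rw [List.range_succ_eq_map, List.map_cons, List.map_map]
  rfl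

theorem Hiter_fB_succ (k : ℕ) (a : ℕ → ℝ) :
    Hiter ((List.range (k + 1 + 1)).map (fB (k + 1) a)) = fun x =>
      ∫ t in x..1, fB (k + 1) a 0 t *
        Hiter ((List.range (k + 1)).map (fB k fun i => a (i + 1))) t := by
  rw [List.range_succ_eq_map, List.map_cons, List.map_map]
  have : fB (k + 1) a ∘ Nat.succ = fB k fun i => a (i + 1) := by
    ext i t
    simp [fB]
  rw [this]
  rfl

open MeasureTheory Set in
/-- The Abel transform turns rational letters into root-valued ones. -/
theorem integral_Hiter_fA_div_sqrt (k : ℕ) (a : ℕ → ℝ) (ha : ∀ i ≤ k, a i < 0) {x : ℝ}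
    (hx : x ∈ Icc (0 : ℝ) 1) :
    ∫ t in x..1, Hiter ((List.range k).map (fun i => fA (a (i + 1)))) t /
        ((t - a 0) * √(t - x)) =
      Hiter ((List.range (k + 1)).map (fB k a)) x / √(x - a 0) := by
  induction k generalizing a x with
  | zero =>
    have h0 : a 0 < x := (ha 0 le_rfl).trans_le hx.1
    have hQ : 0 < √(x - a 0) := Real.sqrt_pos.2 (by linarith)
    have hR : Hiter ((List.range (0 + 1)).map (fB 0 a)) x =
        ∫ s in x..1, (√(s - a 0))⁻¹ * (√(1 - s))⁻¹ := by
      simp only [zero_add, List.range_one, List.map_cons, List.map_nil, Hiter, mul_one]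
      refine intervalIntegral.integral_congr fun s hs => ?_
      rw [uIcc_of_le hx.2] at hs
      simp only [fB, lt_self_iff_false, if_false]
      rw [Real.sqrt_mul (by linarith [hs.2]), mul_inv, mul_comm]
    have hL := intervalIntegral.integral_eq_sub_of_hasDerivAt_of_le hx.2
      (continuousOn_two_mul_arctan_upper (a := a 0) (x := x) _)
      (fun t ht => hasDerivAt_two_mul_arctan_upper h0 ht.1)
      (intervalIntegrable_inv_mul_inv_sqrt h0 hx.2)
    rw [intervalIntegral.integral_const_mul] at hL
    rw [hR, integral_inv_sqrt_mul_inv_sqrt h0 hx.2, eq_div_iff hQ.ne']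
    simp only [List.range_zero, List.map_nil, Hiter, one_div, mul_inv]
    rw [mul_comm, hL]
    simp
  | succ k ih =>
    have h0 : a 0 < x := (ha 0 (by simp)).trans_le hx.1
    have ha' : ∀ i ≤ k, a (i + 1) < 0 := fun i hi => ha _ (by omega)
    have hQ : 0 < √(x - a 0) := Real.sqrt_pos.2 (by linarith)
    have ih' := fun s hs => ih (fun i => a (i + 1)) ha' (x := s) hs
    have hc := continuousOn_Hiter_fA ha'
    rw [Hiter_fB_succ, Hiter_fA_succ]
    set h := Hiter ((List.range k).map fun i => fA (a (i + 1 + 1)))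
    set q : ℝ → ℝ := fun t => fA (a 1) t * h t with hq_def
    have hq : ContinuousOn q (Icc 0 1) := (continuousOn_fA (ha 1 (by omega))).mul hc
    have hsub : Icc x 1 ⊆ Icc 0 1 := Icc_subset_Icc_left hx.1
    have hqx : ContinuousOn q (Icc x 1) := hq.mono hsub
    have hqi : IntervalIntegrable q volume x 1 := hqx.intervalIntegrable_of_Icc hx.2
    have hR : ∫ t in x..1, fB (k + 1) a 0 t *
          Hiter ((List.range (k + 1)).map (fB k fun i => a (i + 1))) t =
        ∫ s in x..1, (√(s - a 0))⁻¹ * ∫ t in s..1, q t * (√(t - s))⁻¹ := by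
      refine intervalIntegral.integral_congr fun s hs => ?_
      rw [uIcc_of_le hx.2] at hs
      have h1 : 0 < √(s - a 1) := Real.sqrt_pos.2 (by linarith [hs.1, hx.1, ha 1 (by omega)])
      have e := ih' s (hsub hs)
      rw [zero_add, eq_div_iff h1.ne'] at e
      simp only [fB, Nat.succ_pos, if_true, zero_add]
      rw [← e, Real.sqrt_mul (by linarith [hs.1])]
      have e2 : ∀ t, h t / ((t - a 1) * √(t - s)) = q t * (√(t - s))⁻¹ := fun t => by
        simp only [hq_def, fA, div_eq_mul_inv, mul_inv]
        ring
      simp only [e2]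
      field_simp
    have hL := intervalIntegral.integral_mul_deriv_eq_deriv_mul_of_hasDerivAt
      (a := x) (b := 1) (u := fun t => ∫ u in t..1, q u) (u' := fun t => -q t)
      (v := fun t => 2 * Real.arctan (√(t - x) / √(x - a 0)))
      (v' := fun t => √(x - a 0) * ((t - a 0)⁻¹ * (√(t - x))⁻¹))
      (intervalIntegral.continuousOn_primitive_interval_left
        (by rw [uIcc_of_le hx.2]; exact hqx.integrableOn_Icc))
      (continuousOn_two_mul_arctan_upper _)
      (fun t ht => by
        rw [min_eq_left hx.2, max_eq_right hx.2] at ht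
        refine intervalIntegral.integral_hasDerivAt_left
          ((hqx.mono (Icc_subset_Icc_left ht.1.le)).intervalIntegrable_of_Icc ht.2.le)
          ((hqx.mono Ioo_subset_Icc_self).stronglyMeasurableAtFilter isOpen_Ioo t ht)
          (hqx.continuousAt (Icc_mem_nhds ht.1 ht.2)))
      (fun t ht => by
        rw [min_eq_left hx.2] at ht
        exact hasDerivAt_two_mul_arctan_upper h0 ht.1)
      hqi.neg (intervalIntegrable_inv_mul_inv_sqrt h0 hx.2)
    have hp : IntervalIntegrable (fun s => (√(s - a 0))⁻¹) volume x 1 := by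
      refine ContinuousOn.intervalIntegrable_of_Icc hx.2 (ContinuousOn.inv₀ (by fun_prop) ?_)
      exact fun s hs => (Real.sqrt_pos.2 (by linarith [hs.1])).ne'
    beta_reduce
    rw [hR, integral_abel_kernel_swap hx.2 hp hqx, eq_div_iff hQ.ne', mul_comm,
      ← intervalIntegral.integral_const_mul]
    have e3 : ∀ t, √(x - a 0) * ((∫ u in t..1, q u) / ((t - a 0) * √(t - x))) =
        (∫ u in t..1, q u) * (√(x - a 0) * ((t - a 0)⁻¹ * (√(t - x))⁻¹)) := fun t => by
      simp only [div_eq_mul_inv, mul_inv]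
      ring
    simp only [e3]
    rw [hL]
    simp only [intervalIntegral.integral_same, sub_self, Real.sqrt_zero, zero_div,
      Real.arctan_zero, mul_zero, zero_mul, zero_sub, neg_mul, intervalIntegral.integral_neg,
      neg_neg]
    refine intervalIntegral.integral_congr fun t ht => ?_
    rw [uIcc_of_le hx.2] at ht
    simp only [integral_inv_sqrt_mul_inv_sqrt h0 ht.1]

/-- Theorem 4.7 (Pattern 1): for `a_0,…,a_k < 0`,
(i) `∫_x^1 H_{a_1,…,a_k}(t)/((t-a_0)√(t-x)) dt = H_{b_0,…,b_k}(x)/√(x-a_0)` for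
all `x ∈ (0,1)`, and
(ii) `C(2N,N)·M[H_{a_1,…,a_k}(x)/(x-a_0)](N)
      = (4^N/π)·M[H_{b_0,…,b_k}(x)/√(x(x-a_0))](N)` for all `N ∈ ℕ`. -/
theorem stmt_7 (k : ℕ) (a : ℕ → ℝ) (ha : ∀ i ≤ k, a i < 0) :
    (∀ x ∈ Set.Ioo (0 : ℝ) 1,
      (∫ t in x..1,
          Hiter ((List.range k).map (fun i => fA (a (i + 1)))) t /
            ((t - a 0) * Real.sqrt (t - x))) =
        Hiter ((List.range (k + 1)).map (fB k a)) x / Real.sqrt (x - a 0)) ∧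
    (∀ N : ℕ,
      (Nat.choose (2 * N) N : ℝ) *
        (∫ x in (0 : ℝ)..1,
          x ^ N * Hiter ((List.range k).map (fun i => fA (a (i + 1)))) x / (x - a 0)) =
      (4 ^ N / Real.pi) *
        ∫ x in (0 : ℝ)..1,
          x ^ N * Hiter ((List.range (k + 1)).map (fB k a)) x /
            Real.sqrt (x * (x - a 0))) := by
  refine ⟨fun x hx => integral_Hiter_fA_div_sqrt k a ha (Set.Ioo_subset_Icc_self hx), fun N => ?_⟩
  have hc := continuousOn_Hiter_fA ha
  have key := fun x (hx : x ∈ Set.Icc (0 : ℝ) 1) => integral_Hiter_fA_div_sqrt k a ha hx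
  set h := Hiter ((List.range k).map fun i => fA (a (i + 1)))
  have hq : ContinuousOn (fun t => h t / (t - a 0)) (Set.Icc 0 1) :=
    hc.div (by fun_prop) fun t ht => by linarith [ht.1, ha 0 (by simp)]
  have hp : IntervalIntegrable (fun x : ℝ => x ^ N * (√x)⁻¹) MeasureTheory.volume 0 1 := by
    refine IntervalIntegrable.continuousOn_mul ?_ (by fun_prop)
    refine (intervalIntegral.intervalIntegrable_rpow' (r := -1 / 2) (by norm_num)).congr
      fun u hu => ?_
    rw [Set.uIoc_of_le zero_le_one] at hu
    simp only [Real.sqrt_eq_rpow, ← Real.rpow_neg hu.1.le]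
    norm_num
  have hR : ∫ x in (0 : ℝ)..1, x ^ N * Hiter ((List.range (k + 1)).map (fB k a)) x /
        √(x * (x - a 0)) =
      ∫ x in (0 : ℝ)..1, x ^ N * (√x)⁻¹ *
        ∫ t in x..1, h t / (t - a 0) * (√(t - x))⁻¹ := by
    refine intervalIntegral.integral_congr fun x hx => ?_
    rw [Set.uIcc_of_le zero_le_one] at hx
    have e : ∀ t, h t / (t - a 0) * (√(t - x))⁻¹ = h t / ((t - a 0) * √(t - x)) := fun t => by
      simp only [div_eq_mul_inv, mul_inv]
      ring
    simp only [e]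
    rw [key x hx, Real.sqrt_mul hx.1]
    simp only [div_eq_mul_inv, mul_inv]
    ring
  rw [hR, integral_abel_kernel_swap zero_le_one hp hq, ← intervalIntegral.integral_const_mul,
    ← intervalIntegral.integral_const_mul]
  refine intervalIntegral.integral_congr_ae (Filter.Eventually.of_forall fun t ht => ?_)
  rw [Set.uIoc_of_le zero_le_one] at ht
  rw [integral_pow_mul_inv_sqrt_mul_inv_sqrt_sub ht.1, Nat.centralBinom]
  have := Real.pi_ne_zero
  field_simp
end

section
/- Let k ≥ 0 and a_0, …, a_k, c < 0. Define letters f_{a_i}(t) = 1/(t−a_i), f_{b_i}(t) = 1/√((t−a_i)(t−a_{i+1})) for i = 0,…,k−1, and f_{b_k}(t) = 1/√((1−t)(t−a_k)). Then for every x ∈ (0,1): (i) ∫_x^1 √(t−a_0)·f_{b_0}(t)·H_{f_{b_1},…,f_{b_k}}(t)/√(t−x) dt = π·H_{f_{a_1},…,f_{a_k}}(x); (ii) ∫_x^1 H_{f_{b_0},…,f_{b_k}}(t)/((t−c)·√((t−a_0)(t−x))) dt = (π/√(x−c))·∫_x^1 H_{f_{a_1},…,f_{a_k}}(t)/((t−a_0)·√(t−c))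 dt; and (iii) with the additional letter f_w(t) = 1/((t−a_0)·√(t−c)), for every natural number N: (1/((2N+1)·C(2N,N)))·∫_0^1 x^N·x·H_{f_{b_0},…,f_{b_k}}(x)/((x−c)·√(x·(x−a_0))) dx = (π/(2·4^N))·∫_0^1 x^N·H_{f_w,f_{a_1},…,f_{a_k}}(x)/√(x−c) dx. -/
/-- The letter `f_w(t) = 1/((t-a_0)·√(t-c))`. -/
noncomputable def fW (a0 c : ℝ) : ℝ → ℝ := fun t =>
  ((t - a0) * Real.sqrt (t - c))⁻¹

open Set MeasureTheory
open scoped ENNReal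

section ChangeOfVariables

/-- Change of variables in a lower Lebesgue integral over open intervals, along a differentiable
bijection `φ` with inverse `ψ`. -/
lemma setLIntegral_Ioo_comp {φ φ' ψ : ℝ → ℝ} {p q x s : ℝ}
    (hφ : MapsTo φ (Ioo p q) (Ioo x s)) (hψ : MapsTo ψ (Ioo x s) (Ioo p q))
    (hl : ∀ t ∈ Ioo p q, ψ (φ t) = t) (hr : ∀ t ∈ Ioo x s, φ (ψ t) = t)
    (hd : ∀ t ∈ Ioo p q, HasDerivAt φ (φ' t) t) {F G : ℝ → ℝ}
    (hFG : ∀ t ∈ Ioo p q, |φ' t| * F (φ t) = G t) :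
    ∫⁻ t in Ioo x s, ENNReal.ofReal (F t) = ∫⁻ t in Ioo p q, ENNReal.ofReal (G t) := by
  have him : φ '' Ioo p q = Ioo x s :=
    Subset.antisymm hφ.image_subset fun t ht => ⟨ψ t, hψ ht, hr t ht⟩
  rw [← him, lintegral_image_eq_lintegral_abs_deriv_mul measurableSet_Ioo
    (fun t ht => (hd t ht).hasDerivWithinAt) (LeftInvOn.injOn (f₁' := ψ) hl)]
  refine setLIntegral_congr_fun measurableSet_Ioo fun t ht => ?_
  rw [← ENNReal.ofReal_mul (abs_nonneg _), hFG t ht]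

/-- Fubini for nonnegative functions on the triangle `x < t < s < y`. -/
lemma lintegral_triangle_swap (x y : ℝ) {F : ℝ → ℝ → ℝ≥0∞}
    (hF : Measurable (Function.uncurry F)) :
    ∫⁻ t in Ioo x y, ∫⁻ s in Ioo t y, F t s = ∫⁻ s in Ioo x y, ∫⁻ t in Ioo x s, F t s := by
  have hm : MeasurableSet {p : ℝ × ℝ | x < p.1 ∧ p.1 < p.2 ∧ p.2 < y} :=
    (measurableSet_lt measurable_const measurable_fst).inter
      ((measurableSet_lt measurable_fst measurable_snd).inter
        (measurableSet_lt measurable_snd measurable_const))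
  have h1 : ∀ t, (Ioo x y).indicator (fun t => ∫⁻ s in Ioo t y, F t s) t =
      ∫⁻ s, {p : ℝ × ℝ | x < p.1 ∧ p.1 < p.2 ∧ p.2 < y}.indicator (Function.uncurry F) (t, s) := by
    intro t
    by_cases ht : t ∈ Ioo x y
    · rw [indicator_of_mem ht, ← lintegral_indicator measurableSet_Ioo]
      refine lintegral_congr fun s => ?_
      have := ht.1
      simp [indicator_apply, this]
    · rw [indicator_of_notMem ht, eq_comm, lintegral_eq_zero_of_ae_eq_zero]
      refine Filter.Eventually.of_forall fun s => indicator_of_notMem (fun h => ht ?_) _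
      exact ⟨h.1, h.2.1.trans h.2.2⟩
  have h2 : ∀ s, (Ioo x y).indicator (fun s => ∫⁻ t in Ioo x s, F t s) s =
      ∫⁻ t, {p : ℝ × ℝ | x < p.1 ∧ p.1 < p.2 ∧ p.2 < y}.indicator (Function.uncurry F) (t, s) := by
    intro s
    by_cases hs : s ∈ Ioo x y
    · rw [indicator_of_mem hs, ← lintegral_indicator measurableSet_Ioo]
      refine lintegral_congr fun t => ?_
      have := hs.2
      simp [indicator_apply, this]
    · rw [indicator_of_notMem hs, eq_comm, lintegral_eq_zero_of_ae_eq_zero]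
      refine Filter.Eventually.of_forall fun t => indicator_of_notMem (fun h => hs ?_) _
      exact ⟨h.1.trans h.2.1, h.2.2⟩
  rw [← lintegral_indicator measurableSet_Ioo, ← lintegral_indicator measurableSet_Ioo]
  simp_rw [h1, h2]
  exact lintegral_lintegral_swap (f := fun t s =>
    {p : ℝ × ℝ | x < p.1 ∧ p.1 < p.2 ∧ p.2 < y}.indicator (Function.uncurry F) (t, s))
    (hF.indicator hm).aemeasurable

end ChangeOfVariables

section Kernels

lemma lintegral_sqrt_kernel {a x s : ℝ} (hax : a < x) (hxs : x < s) :
    ∫⁻ t in Ioo x s, ENNReal.ofReal (√(t - a) * √(t - x))⁻¹ =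
      ∫⁻ t in Ioo x s, ENNReal.ofReal ((t - a)⁻¹ * (√(s - a) / √(s - t))) := by
  have hX : 0 < x - a := sub_pos.2 hax
  have hS : 0 < s - a := by linarith
  have hmem : MapsTo (fun t => a + (x - a) * (s - a) / (t - a)) (Ioo x s) (Ioo x s) := by
    rintro t ⟨h1, h2⟩
    have ht : 0 < t - a := by linarith
    constructor
    · have : x - a < (x - a) * (s - a) / (t - a) := by
        rw [lt_div_iff₀ ht]; exact mul_lt_mul_of_pos_left (by linarith) hX
      linarith
    · have : (x - a) * (s - a) / (t - a) < s - a := by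
        rw [div_lt_iff₀ ht, mul_comm]; exact mul_lt_mul_of_pos_left (by linarith) hS
      linarith
  have hinv : ∀ t ∈ Ioo x s, a + (x - a) * (s - a) / (a + (x - a) * (s - a) / (t - a) - a) = t := by
    rintro t ⟨h1, h2⟩
    have ht : t - a ≠ 0 := by linarith
    have := hX.ne'
    have := hS.ne'
    rw [add_sub_cancel_left]
    field_simp
    ring
  refine setLIntegral_Ioo_comp hmem hmem hinv hinv
    (φ' := fun t => -((x - a) * (s - a)) / (t - a) ^ 2) ?_ ?_
  · rintro t ⟨h1, h2⟩
    have ht : t - a ≠ 0 := by linarith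
    have := (((hasDerivAt_id' t).sub_const a).inv ht).const_mul ((x - a) * (s - a)) |>.const_add a
    exact this.congr_deriv (by ring)
  · rintro t ⟨h1, h2⟩
    have ht : 0 < t - a := by linarith
    have hst : 0 < s - t := by linarith
    have e : a + (x - a) * (s - a) / (t - a) - x = (x - a) * (s - t) / (t - a) := by
      field_simp; ring
    rw [e, add_sub_cancel_left, abs_div, abs_neg, abs_of_pos (mul_pos hX hS), abs_of_pos (pow_pos ht 2),
      Real.sqrt_div (by positivity), Real.sqrt_div (by positivity), Real.sqrt_mul hX.le,
      Real.sqrt_mul hX.le]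
    have := Real.sqrt_pos.2 hX
    have := Real.sqrt_pos.2 hS
    have := Real.sqrt_pos.2 ht
    have := Real.sqrt_pos.2 hst
    have e1 := Real.sq_sqrt hX.le
    have e2 := Real.sq_sqrt hS.le
    have e3 := Real.sq_sqrt ht.le
    generalize √(x - a) = X at *
    generalize √(s - a) = S at *
    generalize √(t - a) = T at *
    generalize √(s - t) = U at *
    rw [← e1, ← e2, ← e3]
    field_simp

lemma lintegral_sqrt_kernel_mul_inv {a c x s : ℝ} (hax : a < x) (hcx : c < x) (hxs : x < s) :
    ∫⁻ t in Ioo x s, ENNReal.ofReal ((t - c) * (√(t - a) * √(t - x)))⁻¹ =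
      ∫⁻ t in Ioo x s, ENNReal.ofReal
        (((t - a) * (√(x - c) * √(t - c)))⁻¹ * (√(s - a) / √(s - t))) := by
  have hX : 0 < x - a := sub_pos.2 hax
  have hS : 0 < s - a := by linarith
  have hY : 0 < x - c := sub_pos.2 hcx
  have hZ : 0 < s - c := by linarith
  set γ : ℝ := x + s - a - c with hγ
  set α : ℝ := x * s - a * c with hα
  set β : ℝ := γ * a * c - α * (a + c) with hβ
  have hγ0 : 0 < γ := by rw [hγ]; linarith
  have hD : ∀ t, x < t → 0 < γ * t - α := by
    intro t ht
    have h1 : γ * x - α = (x - a) * (x - c) := by rw [hγ, hα]; ring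
    have h2 : 0 < (x - a) * (x - c) := by positivity
    nlinarith
  have ex : ∀ t, x < t → (α * t + β) / (γ * t - α) - x =
      (x - a) * (x - c) * (s - t) / (γ * t - α) := by
    intro t ht
    have := (hD t ht).ne'
    rw [div_sub' this]
    congr 1
    rw [hβ, hα, hγ]; ring
  have es : ∀ t, x < t → s - (α * t + β) / (γ * t - α) =
      (s - a) * (s - c) * (t - x) / (γ * t - α) := by
    intro t ht
    have := (hD t ht).ne'
    rw [sub_div' this]
    congr 1
    rw [hβ, hα, hγ]; ring
  have ec : ∀ t, x < t → (α * t + β) / (γ * t - α) - c =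
      (x - c) * (s - c) * (t - a) / (γ * t - α) := by
    intro t ht
    have := (hD t ht).ne'
    rw [div_sub' this]
    congr 1
    rw [hβ, hα, hγ]; ring
  have ea : ∀ t, x < t → (α * t + β) / (γ * t - α) - a =
      (x - a) * (s - a) * (t - c) / (γ * t - α) := by
    intro t ht
    have := (hD t ht).ne'
    rw [div_sub' this]
    congr 1
    rw [hβ, hα, hγ]; ring
  have hmem : MapsTo (fun t => (α * t + β) / (γ * t - α)) (Ioo x s) (Ioo x s) := by
    rintro t ⟨h1, h2⟩
    have h3 := hD t h1
    constructor
    · rw [← sub_pos, ex t h1]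
      have : 0 < s - t := by linarith
      positivity
    · rw [← sub_pos, es t h1]
      have : 0 < t - x := by linarith
      positivity
  have hdet : α ^ 2 + β * γ = (x - a) * (x - c) * (s - a) * (s - c) := by
    rw [hβ, hα, hγ]; ring
  have hdet0 : 0 < α ^ 2 + β * γ := by rw [hdet]; positivity
  have hinv : ∀ t ∈ Ioo x s, (α * ((α * t + β) / (γ * t - α)) + β) /
      (γ * ((α * t + β) / (γ * t - α)) - α) = t := by
    rintro t ht
    have h3 := hD t ht.1
    have h4 := hD _ (hmem ht).1
    have h3' := h3.ne'
    rw [div_eq_iff h4.ne', mul_div_assoc', mul_div_assoc', div_add' _ _ _ h3', div_sub' h3',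
      mul_div_assoc']
    congr 1
    ring
  refine setLIntegral_Ioo_comp hmem hmem hinv hinv
    (φ' := fun t => -(α ^ 2 + β * γ) / (γ * t - α) ^ 2) ?_ ?_
  · rintro t ⟨h1, h2⟩
    have ht := (hD t h1).ne'
    have hn : HasDerivAt (fun t => α * t + β) α t := by
      simpa using ((hasDerivAt_id t).const_mul α).add_const β
    have hd : HasDerivAt (fun t => γ * t - α) γ t := by
      simpa using ((hasDerivAt_id t).const_mul γ).sub_const α
    exact (hn.div hd ht).congr_deriv (by ring)
  · rintro t ⟨h1, h2⟩
    have ht : 0 < t - a := by linarith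
    have htc : 0 < t - c := by linarith
    have hst : 0 < s - t := by linarith
    have hDt := hD t h1
    rw [ex t h1, ec t h1, ea t h1, abs_div, abs_neg, abs_of_pos hdet0, abs_of_pos (pow_pos hDt 2),
      hdet, ← Real.sqrt_mul (by positivity)]
    generalize γ * t - α = D at *
    have e4 : (x - a) * (s - a) * (t - c) / D * ((x - a) * (x - c) * (s - t) / D) =
      ((x - a) / D) ^ 2 * ((s - a) * ((t - c) * ((x - c) * (s - t)))) := by ring
    rw [e4, Real.sqrt_mul (by positivity), Real.sqrt_sq (by positivity), Real.sqrt_mul hS.le,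
      Real.sqrt_mul htc.le, Real.sqrt_mul hY.le]
    have := Real.sqrt_pos.2 hS
    have := Real.sqrt_pos.2 htc
    have := Real.sqrt_pos.2 hY
    have := Real.sqrt_pos.2 hst
    have e2 := Real.sq_sqrt hS.le
    generalize √(s - a) = S at *
    rw [← e2]
    field_simp

end Kernels

section Beta

lemma lintegral_rpow_mul_one_sub_rpow {α β : ℝ} (hα : 0 < α) (hβ : 0 < β) :
    ∫⁻ t in Ioo (0 : ℝ) 1, ENNReal.ofReal (t ^ (α - 1) * (1 - t) ^ (β - 1)) =
      ENNReal.ofReal (ProbabilityTheory.beta α β) := by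
  have hB := ProbabilityTheory.beta_pos hα hβ
  have h := ProbabilityTheory.lintegral_betaPDF_eq_one hα hβ
  rw [ProbabilityTheory.lintegral_betaPDF] at h
  simp_rw [mul_assoc, one_div, ENNReal.ofReal_mul (inv_nonneg.2 hB.le)] at h
  rw [lintegral_const_mul _ (by fun_prop)] at h
  rw [ENNReal.ofReal_inv_of_pos hB, mul_comm, ← div_eq_mul_inv,
    ENNReal.div_eq_one_iff (by simpa using hB) (by simp)] at h
  exact h

lemma lintegral_inv_sqrt_mul_sqrt {x s : ℝ} (hxs : x < s) :
    ∫⁻ t in Ioo x s, ENNReal.ofReal (√(s - t) * √(t - x))⁻¹ = ENNReal.ofReal Real.pi := by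
  have hb : ProbabilityTheory.beta (1 / 2) (1 / 2) = Real.pi := by
    rw [ProbabilityTheory.beta, Real.Gamma_one_half_eq, Real.mul_self_sqrt Real.pi_pos.le]
    norm_num
  rw [← hb, ← lintegral_rpow_mul_one_sub_rpow (by norm_num) (by norm_num)]
  have h : 0 < s - x := sub_pos.2 hxs
  refine setLIntegral_Ioo_comp (φ := fun t => x + (s - x) * t) (ψ := fun t => (t - x) / (s - x))
    (φ' := fun _ => s - x) ?_ ?_ ?_ ?_ ?_ ?_
  · rintro t ⟨h1, h2⟩
    constructor <;> nlinarith
  · rintro t ⟨h1, h2⟩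
    exact ⟨div_pos (by linarith) h, (div_lt_one h).2 (by linarith)⟩
  · intro t _; field_simp; ring
  · intro t _; field_simp; ring
  · intro t _
    simpa using ((hasDerivAt_id t).const_mul (s - x)).const_add x
  · rintro t ⟨h1, h2⟩
    have h3 : 0 < 1 - t := by linarith
    have e1 : s - (x + (s - x) * t) = (s - x) * (1 - t) := by ring
    have e2 : x + (s - x) * t - x = (s - x) * t := by ring
    rw [abs_of_pos h, e1, e2, Real.sqrt_mul h.le, Real.sqrt_mul h.le,
      show (1 / 2 - 1 : ℝ) = -(1 / 2) by norm_num, Real.rpow_neg h1.le, Real.rpow_neg h3.le,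
      ← Real.sqrt_eq_rpow, ← Real.sqrt_eq_rpow]
    have := Real.sqrt_pos.2 h
    have := Real.sqrt_pos.2 h1
    have := Real.sqrt_pos.2 h3
    have e3 := Real.sq_sqrt h.le
    generalize √(s - x) = S at *
    rw [← e3]
    field_simp

lemma beta_nat_add_one_half (N : ℕ) :
    ProbabilityTheory.beta (N + 1) (1 / 2) =
      2 * 4 ^ N / ((2 * N + 1) * ((2 * N).choose N : ℝ)) := by
  rw [← Nat.centralBinom_eq_two_mul_choose]
  induction N with
  | zero =>
    have h := Real.Gamma_add_one (show (1 / 2 : ℝ) ≠ 0 by norm_num)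
    have h0 : Real.Gamma (1 / 2) ≠ 0 := (Real.Gamma_pos_of_pos (by norm_num)).ne'
    simp only [ProbabilityTheory.beta, Nat.cast_zero, zero_add, Real.Gamma_one]
    rw [add_comm, h]
    simp at h0 ⊢
    field_simp
  | succ n ih =>
    have hc := Nat.succ_mul_centralBinom_succ n
    have hc' : ((n : ℝ) + 1) * ((n + 1).centralBinom : ℝ) =
      2 * (2 * n + 1) * (n.centralBinom : ℝ) := by exact_mod_cast hc
    have p1 : (0 : ℝ) < n.centralBinom := by exact_mod_cast n.centralBinom_pos
    have p2 : (0 : ℝ) < (n + 1).centralBinom := by exact_mod_cast (n + 1).centralBinom_pos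
    have g1 := Real.Gamma_add_one (show (n + 1 : ℝ) ≠ 0 by positivity)
    have g2 := Real.Gamma_add_one (show (n + 1 + 1 / 2 : ℝ) ≠ 0 by positivity)
    have p3 := Real.Gamma_pos_of_pos (show (0 : ℝ) < n + 1 + 1 / 2 by positivity)
    rw [ProbabilityTheory.beta, div_eq_iff p3.ne'] at ih
    rw [ProbabilityTheory.beta, Nat.cast_succ, g1,
      show (n + 1 + 1 + 1 / 2 : ℝ) = n + 1 + 1 / 2 + 1 by ring, g2, mul_assoc, ih]
    rw [div_eq_div_iff (by positivity) (by positivity)]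
    field_simp
    rw [pow_succ]
    linear_combination 2 * 4 ^ n * hc'

lemma lintegral_pow_mul_inv_sqrt (N : ℕ) {t : ℝ} (ht : 0 < t) :
    ∫⁻ x in Ioo 0 t, ENNReal.ofReal (x ^ N * (√(t - x))⁻¹) =
      ENNReal.ofReal (2 * 4 ^ N / ((2 * N + 1) * ((2 * N).choose N : ℝ)) * (t ^ N * √t)) := by
  rw [← beta_nat_add_one_half, mul_comm, ENNReal.ofReal_mul (by positivity),
    ← lintegral_rpow_mul_one_sub_rpow (by positivity) (by norm_num),
    ← lintegral_const_mul _ (by fun_prop)]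
  simp_rw [← ENNReal.ofReal_mul (show 0 ≤ t ^ N * √t by positivity)]
  refine setLIntegral_Ioo_comp (φ := fun x => t * x) (ψ := fun x => x / t)
    (φ' := fun _ => t) ?_ ?_ ?_ ?_ ?_ ?_
  · rintro x ⟨h1, h2⟩
    constructor <;> nlinarith
  · rintro x ⟨h1, h2⟩
    exact ⟨div_pos h1 ht, (div_lt_one ht).2 h2⟩
  · intro x _; field_simp
  · intro x _; field_simp
  · intro x _
    simpa using (hasDerivAt_id x).const_mul t
  · rintro x ⟨h1, h2⟩
    have h3 : 0 < 1 - x := by linarith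
    rw [abs_of_pos ht, show t - t * x = t * (1 - x) by ring, Real.sqrt_mul ht.le,
      show (1 / 2 - 1 : ℝ) = -(1 / 2) by norm_num, Real.rpow_neg h3.le, ← Real.sqrt_eq_rpow,
      add_sub_cancel_right, Real.rpow_natCast, mul_pow]
    have := Real.sqrt_pos.2 ht
    have := Real.sqrt_pos.2 h3
    have e3 := Real.sq_sqrt ht.le
    field_simp
    rw [e3]

end Beta

section IteratedIntegrals

/-- The `[0, ∞]`-valued version of `Hiter`, for nonnegative letters. -/
noncomputable def HiterENN : List (ℝ → ℝ) → ℝ → ℝ≥0∞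
  | [], _ => 1
  | g :: gs, x => ∫⁻ t in Ioo x 1, ENNReal.ofReal (g t) * HiterENN gs t

lemma antitone_HiterENN : ∀ l : List (ℝ → ℝ), Antitone (HiterENN l)
  | [] => fun _ _ _ => le_rfl
  | _ :: _ => fun _ _ h => lintegral_mono_set (Ioo_subset_Ioo_left h)

@[fun_prop]
lemma measurable_HiterENN (l : List (ℝ → ℝ)) : Measurable (HiterENN l) :=
  (antitone_HiterENN l).measurable

/-- Measurable functions which are nonnegative and integrable on `(0, 1)`. -/
structure IsNonnegLetter (g : ℝ → ℝ) : Prop where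
  measurable : Measurable g
  nonneg : ∀ t ∈ Ioo (0 : ℝ) 1, 0 ≤ g t
  lintegral_ne_top : ∫⁻ t in Ioo (0 : ℝ) 1, ENNReal.ofReal (g t) ≠ ∞

lemma IsNonnegLetter.of_le {g : ℝ → ℝ} (hm : Measurable g) (h0 : ∀ t ∈ Ioo (0 : ℝ) 1, 0 ≤ g t)
    {C : ℝ} (hC : ∀ t ∈ Ioo (0 : ℝ) 1, g t ≤ C) : IsNonnegLetter g := by
  refine ⟨hm, h0, ne_top_of_le_ne_top (b := ∫⁻ _ in Ioo (0 : ℝ) 1, ENNReal.ofReal C) (by simp) ?_⟩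
  exact setLIntegral_mono measurable_const fun t ht => ENNReal.ofReal_le_ofReal (hC t ht)

lemma HiterENN_ne_top {l : List (ℝ → ℝ)} (hl : ∀ g ∈ l, IsNonnegLetter g) {x : ℝ} (hx : 0 ≤ x) :
    HiterENN l x ≠ ∞ := by
  induction l generalizing x with
  | nil => simp [HiterENN]
  | cons g gs ih =>
    have hgs := ih (fun f hf => hl f (List.mem_cons_of_mem _ hf)) le_rfl
    have hg := hl g List.mem_cons_self
    refine ne_top_of_le_ne_top ?_ (antitone_HiterENN (g :: gs) hx)
    refine ne_top_of_le_ne_top (ENNReal.mul_ne_top hg.lintegral_ne_top hgs) ?_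
    have := hg.measurable
    rw [HiterENN, ← lintegral_mul_const _ (by fun_prop)]
    refine setLIntegral_mono (by fun_prop) fun t ht => ?_
    gcongr
    exact antitone_HiterENN gs ht.1.le

lemma intervalIntegral_eq_toReal_lintegral {F : ℝ → ℝ} {G : ℝ → ℝ≥0∞} (hG : Measurable G) {x : ℝ}
    (hx : x ≤ 1) (hfin : ∀ t ∈ Ioo x 1, G t ≠ ∞) (hF : ∀ t ∈ Ioo x 1, F t = (G t).toReal) :
    ∫ t in x..1, F t = (∫⁻ t in Ioo x 1, G t).toReal := by
  rw [intervalIntegral.integral_of_le hx, integral_Ioc_eq_integral_Ioo,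
    setIntegral_congr_fun measurableSet_Ioo hF, integral_toReal hG.aemeasurable]
  exact ae_restrict_of_forall_mem measurableSet_Ioo fun t ht => (hfin t ht).lt_top

lemma Hiter_eq_toReal {l : List (ℝ → ℝ)} (hl : ∀ g ∈ l, IsNonnegLetter g) {x : ℝ} (hx : 0 ≤ x)
    (hx1 : x ≤ 1) : Hiter l x = (HiterENN l x).toReal := by
  induction l generalizing x with
  | nil => simp [HiterENN, Hiter]
  | cons g gs ih =>
    have hgs := fun f hf => hl f (List.mem_cons_of_mem g hf)
    have hg := hl g List.mem_cons_self
    have := hg.measurable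
    refine intervalIntegral_eq_toReal_lintegral (by fun_prop) hx1 (fun t ht => ?_) fun t ht => ?_
    · exact ENNReal.mul_ne_top ENNReal.ofReal_ne_top (HiterENN_ne_top hgs (hx.trans ht.1.le))
    · have ht0 : 0 < t := hx.trans_lt ht.1
      rw [ENNReal.toReal_mul, ENNReal.toReal_ofReal (hg.nonneg t ⟨ht0, ht.2⟩),
        ih hgs ht0.le ht.2.le]

lemma isNonnegLetter_fA {b : ℝ} (hb : b < 0) : IsNonnegLetter (fA b) := by
  refine .of_le (C := (-b)⁻¹) (by unfold fA; fun_prop) (fun t ht => ?_) (fun t ht => ?_)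
  · exact inv_nonneg.2 (by linarith [ht.1])
  · exact inv_anti₀ (by linarith) (by linarith [ht.1])

lemma isNonnegLetter_fW {b c : ℝ} (hb : b < 0) (hc : c < 0) : IsNonnegLetter (fW b c) := by
  have hb' : 0 < -b := by linarith
  have hc' : 0 < √(-c) := Real.sqrt_pos.2 (by linarith)
  refine .of_le (C := (-b * √(-c))⁻¹) (by unfold fW; fun_prop) (fun t ht => ?_) (fun t ht => ?_)
  · have : 0 < t - b := by linarith [ht.1]
    unfold fW
    positivity
  · refine inv_anti₀ (by positivity) ?_
    have := ht.1
    gcongr <;> linarith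

lemma isNonnegLetter_fB {k : ℕ} {a : ℕ → ℝ} (ha : ∀ i ≤ k, a i < 0) (i : ℕ) :
    IsNonnegLetter (fB k a i) := by
  unfold fB
  by_cases hi : i < k
  · simp only [hi, if_true]
    have h1 := ha i hi.le
    have h2 := ha (i + 1) hi
    have h3 : 0 < -a i * -a (i + 1) := mul_pos (by linarith) (by linarith)
    refine .of_le (C := (√(-a i * -a (i + 1)))⁻¹) (by fun_prop)
      (fun t ht => by positivity) (fun t ht => ?_)
    refine inv_anti₀ (Real.sqrt_pos.2 h3) (Real.sqrt_le_sqrt ?_)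
    have := ht.1
    exact mul_le_mul (by linarith) (by linarith) (by linarith) (by linarith)
  · simp only [hi, if_false]
    have h1 := ha k le_rfl
    refine ⟨by fun_prop, fun t ht => by positivity, ?_⟩
    have hfin : ENNReal.ofReal Real.pi ≠ ∞ := ENNReal.ofReal_ne_top
    rw [← lintegral_inv_sqrt_mul_sqrt zero_lt_one] at hfin
    refine ne_top_of_le_ne_top hfin (setLIntegral_mono (by fun_prop) fun t ht => ?_)
    have h2 := ht.1
    have h3 : 0 < 1 - t := by linarith [ht.2]
    rw [Real.sqrt_mul h3.le, sub_zero]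
    gcongr
    linarith

lemma fB_succ (k : ℕ) (a : ℕ → ℝ) (i : ℕ) :
    fB (k + 1) a (i + 1) = fB k (fun j => a (j + 1)) i := by
  ext t
  simp [fB]

end IteratedIntegrals

section AbelTransform

lemma lintegral_transfer {u v : ℝ → ℝ} {g A : ℝ → ℝ≥0∞} {a x : ℝ} {P : ℝ≥0∞} (hu : Measurable u)
    (hv : Measurable v) (hg : Measurable g) (hA : Measurable A)
    (hker : ∀ s ∈ Ioo x 1, ∫⁻ t in Ioo x s, ENNReal.ofReal (u t) =
      ∫⁻ t in Ioo x s, ENNReal.ofReal (v t * (√(s - a) / √(s - t))))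
    (hgA : ∀ t ∈ Ioo x 1,
      ∫⁻ s in Ioo t 1, ENNReal.ofReal (√(s - a) / √(s - t)) * g s = P * A t) :
    ∫⁻ t in Ioo x 1, ENNReal.ofReal (u t) * ∫⁻ s in Ioo t 1, g s =
      P * ∫⁻ t in Ioo x 1, ENNReal.ofReal (v t) * A t := by
  calc
    _ = ∫⁻ t in Ioo x 1, ∫⁻ s in Ioo t 1, ENNReal.ofReal (u t) * g s := by
      simp_rw [lintegral_const_mul _ hg]
    _ = ∫⁻ s in Ioo x 1, ∫⁻ t in Ioo x s, ENNReal.ofReal (u t) * g s :=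
      lintegral_triangle_swap x 1 (by unfold Function.uncurry; fun_prop)
    _ = ∫⁻ s in Ioo x 1, ∫⁻ t in Ioo x s,
          ENNReal.ofReal (v t * (√(s - a) / √(s - t))) * g s := by
      refine setLIntegral_congr_fun measurableSet_Ioo fun s hs => ?_
      rw [lintegral_mul_const _ (by fun_prop), lintegral_mul_const _ (by fun_prop), hker s hs]
    _ = ∫⁻ t in Ioo x 1, ∫⁻ s in Ioo t 1,
          ENNReal.ofReal (v t * (√(s - a) / √(s - t))) * g s :=
      (lintegral_triangle_swap x 1 (by unfold Function.uncurry; fun_prop)).symm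
    _ = ∫⁻ t in Ioo x 1, P * (ENNReal.ofReal (v t) * A t) := by
      refine setLIntegral_congr_fun measurableSet_Ioo fun t ht => ?_
      have h (s : ℝ) : 0 ≤ √(s - a) / √(s - t) := by positivity
      simp_rw [ENNReal.ofReal_mul' (h _), mul_assoc]
      rw [lintegral_const_mul _ (by fun_prop), hgA t ht, mul_left_comm]
    _ = _ := lintegral_const_mul _ (by fun_prop)

lemma lintegral_fB_HiterENN {k : ℕ} {a : ℕ → ℝ} (ha : ∀ i ≤ k, a i < 0) {x : ℝ} (hx : 0 ≤ x)
    (hx1 : x < 1) :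
    ∫⁻ t in Ioo x 1, ENNReal.ofReal (√(t - a 0) / √(t - x)) *
        (ENNReal.ofReal (fB k a 0 t) *
          HiterENN ((List.range k).map fun i => fB k a (i + 1)) t) =
      ENNReal.ofReal Real.pi * HiterENN ((List.range k).map fun i => fA (a (i + 1))) x := by
  induction k generalizing a x with
  | zero =>
    simp only [List.range_zero, List.map_nil, HiterENN, mul_one]
    rw [← lintegral_inv_sqrt_mul_sqrt hx1]
    refine setLIntegral_congr_fun measurableSet_Ioo fun t ht => ?_
    have h0 : 0 < t - a 0 := by linarith [ht.1, ha 0 le_rfl]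
    have h1 : 0 < 1 - t := by linarith [ht.2]
    rw [← ENNReal.ofReal_mul (by positivity)]
    congr 1
    simp only [fB, lt_irrefl, if_false]
    rw [Real.sqrt_mul h1.le]
    have := Real.sqrt_pos.2 h0
    field_simp
  | succ k ih =>
    have ha' : ∀ i ≤ k, a (i + 1) < 0 := fun i hi => ha _ (Nat.succ_le_succ hi)
    have hB := (isNonnegLetter_fB ha' 0).measurable
    have h := lintegral_transfer (a := a 1) (P := ENNReal.ofReal Real.pi)
      (u := fun t => (√(t - a 1) * √(t - x))⁻¹) (v := fA (a 1))
      (g := fun s => ENNReal.ofReal (fB k (fun j => a (j + 1)) 0 s) *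
        HiterENN ((List.range k).map fun i => fB k (fun j => a (j + 1)) (i + 1)) s)
      (A := HiterENN ((List.range k).map fun i => fA (a (i + 1 + 1)))) (x := x)
      (by fun_prop) (by unfold fA; fun_prop) (by fun_prop) (by fun_prop)
      (fun s hs => lintegral_sqrt_kernel (by linarith [ha' 0 (Nat.zero_le _)]) hs.1)
      (fun t ht => ih (a := fun j => a (j + 1)) ha' (hx.trans ht.1.le) ht.2)
    simp only [fB_succ]
    rw [List.range_succ_eq_map, List.map_cons, List.map_cons, List.map_map, List.map_map]
    simp only [HiterENN]
    refine Eq.trans (setLIntegral_congr_fun measurableSet_Ioo fun t ht => ?_) h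
    have h0 : 0 < t - a 0 := by linarith [ht.1, ha 0 (Nat.zero_le _)]
    rw [← mul_assoc, ← ENNReal.ofReal_mul (by positivity)]
    congr 2
    simp only [fB, Nat.succ_pos, if_true]
    rw [Real.sqrt_mul h0.le]
    have := Real.sqrt_pos.2 h0
    field_simp

lemma lintegral_HiterENN_fB {k : ℕ} {a : ℕ → ℝ} {c : ℝ} (ha : ∀ i ≤ k, a i < 0) (hc : c < 0)
    {x : ℝ} (hx : 0 ≤ x) :
    ∫⁻ t in Ioo x 1, ENNReal.ofReal ((t - c) * (√(t - a 0) * √(t - x)))⁻¹ *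
        HiterENN ((List.range (k + 1)).map (fB k a)) t =
      ENNReal.ofReal Real.pi * ∫⁻ t in Ioo x 1,
        ENNReal.ofReal ((t - a 0) * (√(x - c) * √(t - c)))⁻¹ *
          HiterENN ((List.range k).map fun i => fA (a (i + 1))) t := by
  rw [List.range_succ_eq_map, List.map_cons, List.map_map]
  have hB := (isNonnegLetter_fB ha 0).measurable
  exact lintegral_transfer (a := a 0) (by fun_prop) (by fun_prop) (by fun_prop) (by fun_prop)
    (fun s hs => lintegral_sqrt_kernel_mul_inv (by linarith [ha 0 (Nat.zero_le _)])
      (by linarith) hs.1)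
    (fun t ht => lintegral_fB_HiterENN ha (hx.trans ht.1.le) ht.2)

lemma lintegral_pow_mul_abel {N : ℕ} {u : ℝ → ℝ} {g : ℝ → ℝ≥0∞} (hu : Measurable u)
    (hg : Measurable g) :
    ∫⁻ x in Ioo 0 1, ENNReal.ofReal (x ^ N) *
        ∫⁻ t in Ioo x 1, ENNReal.ofReal (u t * (√(t - x))⁻¹) * g t =
      ENNReal.ofReal (2 * 4 ^ N / ((2 * N + 1) * ((2 * N).choose N : ℝ))) *
        ∫⁻ t in Ioo 0 1, ENNReal.ofReal (t ^ N * √t * u t) * g t := by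
  calc
    _ = ∫⁻ x in Ioo 0 1, ∫⁻ t in Ioo x 1,
          ENNReal.ofReal (x ^ N) * (ENNReal.ofReal (u t * (√(t - x))⁻¹) * g t) := by
      refine lintegral_congr fun x => ?_
      rw [lintegral_const_mul _ (by fun_prop)]
    _ = ∫⁻ t in Ioo 0 1, ∫⁻ x in Ioo 0 t,
          ENNReal.ofReal (x ^ N) * (ENNReal.ofReal (u t * (√(t - x))⁻¹) * g t) :=
      lintegral_triangle_swap 0 1 (by unfold Function.uncurry; fun_prop)
    _ = ∫⁻ t in Ioo 0 1, ∫⁻ x in Ioo 0 t,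
          ENNReal.ofReal (x ^ N * (√(t - x))⁻¹) * (ENNReal.ofReal (u t) * g t) := by
      refine lintegral_congr fun t => setLIntegral_congr_fun measurableSet_Ioo fun x hx => ?_
      have h : 0 ≤ (√(t - x))⁻¹ := by positivity
      rw [ENNReal.ofReal_mul' h, ENNReal.ofReal_mul' h]
      ring
    _ = ∫⁻ t in Ioo 0 1, ENNReal.ofReal (2 * 4 ^ N / ((2 * N + 1) * ((2 * N).choose N : ℝ))) *
          (ENNReal.ofReal (t ^ N * √t * u t) * g t) := by
      refine setLIntegral_congr_fun measurableSet_Ioo fun t ht => ?_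
      have h0 := ht.1
      rw [lintegral_mul_const _ (by fun_prop), lintegral_pow_mul_inv_sqrt N h0,
        ENNReal.ofReal_mul (by positivity), ENNReal.ofReal_mul (p := t ^ N * √t) (by positivity)]
      ring
    _ = _ := lintegral_const_mul _ (by fun_prop)

lemma lintegral_pow_HiterENN_fB {k : ℕ} {a : ℕ → ℝ} {c : ℝ} (ha : ∀ i ≤ k, a i < 0) (hc : c < 0)
    (N : ℕ) :
    ENNReal.ofReal (2 * 4 ^ N / ((2 * N + 1) * ((2 * N).choose N : ℝ))) *
        ∫⁻ t in Ioo 0 1, ENNReal.ofReal (t ^ N * √t * ((t - c) * √(t - a 0))⁻¹) *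
          HiterENN ((List.range (k + 1)).map (fB k a)) t =
      ENNReal.ofReal Real.pi * ∫⁻ x in Ioo 0 1, ENNReal.ofReal (x ^ N * (√(x - c))⁻¹) *
        HiterENN (fW (a 0) c :: (List.range k).map fun i => fA (a (i + 1))) x := by
  have hW := (isNonnegLetter_fW (ha 0 (Nat.zero_le _)) hc).measurable
  rw [← lintegral_pow_mul_abel (by fun_prop) (by fun_prop),
    ← lintegral_const_mul _ (by fun_prop)]
  refine setLIntegral_congr_fun measurableSet_Ioo fun x hx => ?_
  have h := lintegral_HiterENN_fB ha hc hx.1.le (k := k)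
  simp_rw [← mul_inv, mul_assoc (_ - c) (√_) (√_)]
  rw [h, mul_left_comm, ENNReal.ofReal_mul' (by positivity), mul_assoc, HiterENN]
  congr 2
  rw [← lintegral_const_mul _ (by fun_prop)]
  refine lintegral_congr fun t => ?_
  have h1 : 0 ≤ (√(x - c))⁻¹ := by positivity
  rw [← mul_assoc (ENNReal.ofReal _), ← ENNReal.ofReal_mul h1]
  congr 2
  simp only [fW, mul_inv]
  ring

end AbelTransform

/-- Theorem 4.8 (Pattern 2), parts (4.24), (4.25) and (4.21): for
`a_0,…,a_k, c < 0`, with letters as above, for all `x ∈ (0,1)`: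
(i) `∫_x^1 √(t-a_0)·f_{b_0}(t)·H_{b_1,…,b_k}(t)/√(t-x) dt = π·H_{a_1,…,a_k}(x)`;
(ii) `∫_x^1 H_{b_0,…,b_k}(t)/((t-c)√((t-a_0)(t-x))) dt
       = (π/√(x-c))·∫_x^1 H_{a_1,…,a_k}(t)/((t-a_0)√(t-c)) dt`;
and for all `N ∈ ℕ`:
(iii) `(1/((2N+1)·C(2N,N)))·M[x·H_{b_0,…,b_k}(x)/((x-c)√(x(x-a_0)))](N)
       = (π/(2·4^N))·M[H_{w,a_1,…,a_k}(x)/√(x-c)](N)`. -/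
theorem stmt_8 (k : ℕ) (a : ℕ → ℝ) (c : ℝ) (ha : ∀ i ≤ k, a i < 0) (hc : c < 0) :
    (∀ x ∈ Set.Ioo (0 : ℝ) 1,
      ((∫ t in x..1,
          Real.sqrt (t - a 0) * fB k a 0 t *
            Hiter ((List.range k).map (fun i => fB k a (i + 1))) t /
              Real.sqrt (t - x)) =
        Real.pi * Hiter ((List.range k).map (fun i => fA (a (i + 1)))) x) ∧
      ((∫ t in x..1,
          Hiter ((List.range (k + 1)).map (fB k a)) t /
            ((t - c) * Real.sqrt ((t - a 0) * (t - x)))) =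
        (Real.pi / Real.sqrt (x - c)) *
          ∫ t in x..1,
            Hiter ((List.range k).map (fun i => fA (a (i + 1)))) t /
              ((t - a 0) * Real.sqrt (t - c)))) ∧
    (∀ N : ℕ,
      (1 / ((2 * (N : ℝ) + 1) * (Nat.choose (2 * N) N : ℝ))) *
        (∫ x in (0 : ℝ)..1,
          x ^ N * (x * Hiter ((List.range (k + 1)).map (fB k a)) x /
            ((x - c) * Real.sqrt (x * (x - a 0))))) =
      (Real.pi / (2 * 4 ^ N)) *
        ∫ x in (0 : ℝ)..1,
          x ^ N *
            Hiter (fW (a 0) c :: (List.range k).map (fun i => fA (a (i + 1)))) x /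
              Real.sqrt (x - c)) := by
  have hb : ∀ g ∈ (List.range (k + 1)).map (fB k a), IsNonnegLetter g := by
    simpa using fun i _ => isNonnegLetter_fB ha i
  have hb' : ∀ g ∈ (List.range k).map (fun i => fB k a (i + 1)), IsNonnegLetter g := by
    simpa using fun i _ => isNonnegLetter_fB ha (i + 1)
  have hA : ∀ g ∈ (List.range k).map (fun i => fA (a (i + 1))), IsNonnegLetter g := by
    simpa using fun i hi => isNonnegLetter_fA (ha (i + 1) hi)
  have ha0 := ha 0 (Nat.zero_le _)
  have hWA : ∀ g ∈ fW (a 0) c :: (List.range k).map (fun i => fA (a (i + 1))),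
      IsNonnegLetter g := List.forall_mem_cons.2 ⟨isNonnegLetter_fW ha0 hc, hA⟩
  have hB0 := isNonnegLetter_fB ha 0
  have hB0m := hB0.measurable
  refine ⟨fun x hx => ⟨?_, ?_⟩, fun N => ?_⟩
  · rw [Hiter_eq_toReal hA hx.1.le hx.2.le, ← ENNReal.toReal_ofReal Real.pi_pos.le,
      ← ENNReal.toReal_mul, ← lintegral_fB_HiterENN ha hx.1.le hx.2]
    refine intervalIntegral_eq_toReal_lintegral (by fun_prop) hx.2.le (fun t ht => ?_)
      fun t ht => ?_ <;> have ht0 : 0 < t := hx.1.trans ht.1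
    · exact ENNReal.mul_ne_top ENNReal.ofReal_ne_top
        (ENNReal.mul_ne_top ENNReal.ofReal_ne_top (HiterENN_ne_top hb' ht0.le))
    · rw [Hiter_eq_toReal hb' ht0.le ht.2.le, ENNReal.toReal_mul, ENNReal.toReal_mul,
        ENNReal.toReal_ofReal (by positivity), ENNReal.toReal_ofReal (hB0.nonneg t ⟨ht0, ht.2⟩)]
      ring
  · have h := congrArg ENNReal.toReal (lintegral_HiterENN_fB ha hc hx.1.le (k := k))
    rw [ENNReal.toReal_mul, ENNReal.toReal_ofReal Real.pi_pos.le,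
      ← intervalIntegral_eq_toReal_lintegral (F := fun t =>
        Hiter ((List.range (k + 1)).map (fB k a)) t / ((t - c) * √((t - a 0) * (t - x))))
        (by fun_prop) hx.2.le,
      ← intervalIntegral_eq_toReal_lintegral (F := fun t => (√(x - c))⁻¹ *
        (Hiter ((List.range k).map (fun i => fA (a (i + 1)))) t / ((t - a 0) * √(t - c))))
        (by fun_prop) hx.2.le] at h
    · rw [h, intervalIntegral.integral_const_mul, div_eq_mul_inv, mul_assoc]
    all_goals
      intro t ht
      have ht0 : 0 < t := hx.1.trans ht.1
      have h1 : 0 < t - a 0 := by linarith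
      have h2 : 0 < t - c := by linarith
    · exact ENNReal.mul_ne_top ENNReal.ofReal_ne_top (HiterENN_ne_top hA ht0.le)
    · rw [Hiter_eq_toReal hA ht0.le ht.2.le, ENNReal.toReal_mul,
        ENNReal.toReal_ofReal (by positivity)]
      simp only [mul_inv, div_eq_mul_inv]
      ring
    · exact ENNReal.mul_ne_top ENNReal.ofReal_ne_top (HiterENN_ne_top hb ht0.le)
    · rw [Hiter_eq_toReal hb ht0.le ht.2.le, ENNReal.toReal_mul,
        ENNReal.toReal_ofReal (by positivity), Real.sqrt_mul h1.le]
      ring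
  · have h := congrArg ENNReal.toReal (lintegral_pow_HiterENN_fB ha hc N (k := k))
    rw [ENNReal.toReal_mul, ENNReal.toReal_mul, ENNReal.toReal_ofReal Real.pi_pos.le,
      ENNReal.toReal_ofReal (by positivity),
      ← intervalIntegral_eq_toReal_lintegral (F := fun x =>
        x ^ N * (x * Hiter ((List.range (k + 1)).map (fB k a)) x /
            ((x - c) * √(x * (x - a 0)))))
        (by fun_prop) zero_le_one,
      ← intervalIntegral_eq_toReal_lintegral (F := fun x => x ^ N *
        Hiter (fW (a 0) c :: (List.range k).map (fun i => fA (a (i + 1)))) x / √(x - c))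
        (by fun_prop) zero_le_one] at h
    · rw [div_mul_eq_mul_div Real.pi, ← h]
      have : (0 : ℝ) < (2 * N).choose N := by
        exact_mod_cast Nat.choose_pos (by lia)
      field_simp
    all_goals
      intro t ht
      have ht0 : 0 < t := ht.1
      have h1 : 0 < t - a 0 := by linarith
      have h2 : 0 < t - c := by linarith
    · exact ENNReal.mul_ne_top ENNReal.ofReal_ne_top (HiterENN_ne_top hWA ht0.le)
    · rw [Hiter_eq_toReal hWA ht0.le ht.2.le, ENNReal.toReal_mul,
        ENNReal.toReal_ofReal (by positivity)]
      ring
    · exact ENNReal.mul_ne_top ENNReal.ofReal_ne_top (HiterENN_ne_top hb ht0.le)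
    · rw [Hiter_eq_toReal hb ht0.le ht.2.le, ENNReal.toReal_mul,
        ENNReal.toReal_ofReal (by positivity), Real.sqrt_mul ht0.le]
      have e := Real.sq_sqrt ht0.le
      have := Real.sqrt_pos.2 ht0
      have := Real.sqrt_pos.2 h1
      field_simp
      rw [e, mul_comm]
end
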